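/- arXiv:2311.09405 — 2 statements merged into one kernel-verified Lean document; each statement's English description precedes it below -/
import Mathlib

section
/- There exist constants r* ∈ (0,1), N ≥ 1, a̲ ≥ 1, θ ∈ (0,1) and C > 0 with the following property. For every a ≥ a̲ there is a continuously differentiable function ψ_a : [r*·a⁻¹, 1 + a⁻²/100] → ℝ which is twice continuously differentiable away from a finite set of points and which satisfies, at every point x of its domain where it is twice differentiable: ψ_a(x)·ψ_a''(x) − ½·ψ_a'(x)² + x⁻²·(1 − ψ_a(x))·(x·ψ_a'(x) + 2ψ_a(x)) − x·ψ_a'(x) ≤ −¼·a⁻⁴·x⁻⁵ if x ∈ [N·a⁻¹, 1 + a⁻²/100], and this expression is ≤ −½·a if x ∈ [r*·a⁻¹, N·a⁻¹]. Moreover: ψ_a(x) ≤ C·a⁻² for x ∈ [1/10, 1 + a⁻²/100]; ψ_a(x) ≤ 2·a⁻²·x⁻² for x ∈ [N·a⁻¹, 1 + a⁻²/100]; ψ_a(x) ≥ a⁻⁴/32 for all x in the domain; ψ_a(x) ≥ a⁻²·(x⁻² − 1) + a⁻⁴/16 for x ∈ [1 − θ, 1 + a⁻²/100]; and ψ_a(r*·a⁻¹)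 ≥ 3/2. -/
/-- The left-hand side of the self-similar rotationally symmetric Ricci flow equation, as a function
of a point and of the values there of a profile and its first two derivatives. -/
noncomputable def barrierOperator (x p p' p'' : ℝ) : ℝ :=
  p * p'' - p' ^ 2 / 2 + x⁻¹ ^ 2 * (1 - p) * (x * p' + 2 * p) - x * p'

section Gluing

/-- Two functions that agree to first order at `c`, glued there. -/
theorem hasDerivAt_ite_le {f g f' g' : ℝ → ℝ} {c x : ℝ} (hf : HasDerivAt f (f' x) x)
    (hg : HasDerivAt g (g' x) x) (hc : f c = g c) (hc' : f' c = g' c) :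
    HasDerivAt (fun y => if y ≤ c then f y else g y) (if x ≤ c then f' x else g' x) x := by
  rcases lt_trichotomy x c with h | rfl | h
  · rw [if_pos h.le]
    refine hf.congr_of_eventuallyEq ?_
    filter_upwards [Iio_mem_nhds h] with y hy
    exact if_pos (le_of_lt hy)
  · rw [if_pos le_rfl]
    have h1 : HasDerivWithinAt (fun y => if y ≤ x then f y else g y) (f' x) (Set.Iic x) x :=
      hf.hasDerivWithinAt.congr (fun y hy => if_pos hy) (if_pos le_rfl)
    have h2 : HasDerivWithinAt (fun y => if y ≤ x then f y else g y) (f' x) (Set.Ici x) x := by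
      rw [hc']
      refine hg.hasDerivWithinAt.congr (fun y hy => ?_) ((if_pos le_rfl).trans hc)
      rcases eq_or_lt_of_le (Set.mem_Ici.1 hy) with rfl | hlt
      · exact (if_pos le_rfl).trans hc
      · exact if_neg (not_le.2 hlt)
    simpa [Set.Iic_union_Ici, hasDerivWithinAt_univ] using h1.union h2
  · rw [if_neg (not_le.2 h)]
    refine hg.congr_of_eventuallyEq ?_
    filter_upwards [Ioi_mem_nhds h] with y hy
    exact if_neg (not_le.2 hy)

theorem contDiffOn_one_ite_le {f g f' g' : ℝ → ℝ} {c : ℝ} {s : Set ℝ} (hs : IsOpen s)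
    (hf : ∀ x ∈ s, HasDerivAt f (f' x) x) (hg : ∀ x ∈ s, HasDerivAt g (g' x) x)
    (hf' : ContinuousOn f' s) (hg' : ContinuousOn g' s) (hc : f c = g c) (hc' : f' c = g' c) :
    ContDiffOn ℝ 1 (fun y => if y ≤ c then f y else g y) s := by
  have hd := fun x hx => hasDerivAt_ite_le (hf x hx) (hg x hx) hc hc'
  rw [show (1 : WithTop ℕ∞) = 0 + 1 by simp, contDiffOn_succ_iff_deriv_of_isOpen hs]
  refine ⟨fun x hx => (hd x hx).differentiableAt.differentiableWithinAt, by simp, ?_⟩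
  rw [contDiffOn_zero]
  refine ContinuousOn.congr (f := fun x => if x ≤ c then f' x else g' x) ?_
    fun x hx => (hd x hx).deriv
  refine ContinuousOn.if ?_ (hf'.mono Set.inter_subset_left) (hg'.mono Set.inter_subset_left)
  rintro x ⟨-, hx⟩
  have : x = c := by simpa [frontier_Iic] using (show x ∈ frontier (Set.Iic c) from hx)
  rw [this, hc']

end Gluing

section Rescaling

variable {φ φ' φ'' : ℝ → ℝ} {a σ x : ℝ}

theorem barrierOperator_of_rescaling {ψ : ℝ → ℝ} {t : Set ℝ} (ht : IsOpen t) (hx : a * x ∈ t)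
    (hφ : ∀ r ∈ t, HasDerivAt φ (φ' r) r) (hφ' : ∀ r ∈ t, HasDerivAt φ' (φ'' r) r)
    (hψ : ∀ y, a * y ∈ t → ψ y = φ (a * y) - σ) :
    ψ x * deriv (deriv ψ) x - (deriv ψ x) ^ 2 / 2
        + x⁻¹ ^ 2 * (1 - ψ x) * (x * deriv ψ x + 2 * ψ x) - x * deriv ψ x =
      barrierOperator x (φ (a * x) - σ) (a * φ' (a * x)) (a ^ 2 * φ'' (a * x)) := by
  have hopen : IsOpen ((fun y => a * y) ⁻¹' t) := ht.preimage (by fun_prop)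
  have hlin : ∀ y : ℝ, HasDerivAt (fun y => a * y) a y := fun y => by
    simpa using (hasDerivAt_id y).const_mul a
  have h1 : ∀ y, a * y ∈ t → HasDerivAt ψ (a * φ' (a * y)) y := fun y hy => by
    have h : HasDerivAt (fun y => φ (a * y) - σ) (φ' (a * y) * a) y :=
      ((hφ _ hy).comp y (hlin y)).sub_const σ
    rw [mul_comm] at h
    refine h.congr_of_eventuallyEq ?_
    filter_upwards [hopen.mem_nhds hy] with z hz using hψ z hz
  have h2 : HasDerivAt (deriv ψ) (a ^ 2 * φ'' (a * x)) x := by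
    have h : HasDerivAt (fun y => a * φ' (a * y)) (a * (φ'' (a * x) * a)) x :=
      ((hφ' _ hx).comp x (hlin x)).const_mul a
    rw [show a ^ 2 * φ'' (a * x) = a * (φ'' (a * x) * a) by ring]
    refine h.congr_of_eventuallyEq ?_
    filter_upwards [hopen.mem_nhds hx] with z hz using (h1 z hz).deriv
  rw [h2.deriv, (h1 x hx).deriv, hψ x hx, barrierOperator]

end Rescaling

section Profiles

/-- The inner profile, the square of a concave quadratic. -/
noncomputable def innerProfile (r : ℝ) : ℝ := (855361 / 625000 - 699111 / 1562500000 * r ^ 2) ^ 2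

noncomputable def innerProfileDeriv (r : ℝ) : ℝ :=
  -4 * (855361 / 625000 - 699111 / 1562500000 * r ^ 2) * (699111 / 1562500000 * r)

noncomputable def innerProfileDerivTwo (r : ℝ) : ℝ :=
  8 * (699111 / 1562500000 * r) ^ 2
    - 4 * (855361 / 625000 - 699111 / 1562500000 * r ^ 2) * (699111 / 1562500000)

/-- The outer profile, asymptotic to `r⁻² + 10 r⁻⁴`. -/
noncomputable def outerProfile (r : ℝ) : ℝ :=
  r⁻¹ ^ 2 + 10 * r⁻¹ ^ 4 + 77623 / 1250000 * 2500 ^ 9 * r⁻¹ ^ 18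

noncomputable def outerProfileDeriv (r : ℝ) : ℝ :=
  -(2 * r⁻¹ ^ 3 + 40 * r⁻¹ ^ 5 + 18 * (77623 / 1250000 * 2500 ^ 9) * r⁻¹ ^ 19)

noncomputable def outerProfileDerivTwo (r : ℝ) : ℝ :=
  6 * r⁻¹ ^ 4 + 200 * r⁻¹ ^ 6 + 342 * (77623 / 1250000 * 2500 ^ 9) * r⁻¹ ^ 20

theorem hasDerivAt_innerProfile (r : ℝ) : HasDerivAt innerProfile (innerProfileDeriv r) r := by
  refine ((((hasDerivAt_pow 2 r).const_mul (699111 / 1562500000 : ℝ)).const_sub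
    (855361 / 625000 : ℝ)).fun_pow 2).congr_deriv ?_
  simp [innerProfileDeriv]
  ring

theorem hasDerivAt_innerProfileDeriv (r : ℝ) :
    HasDerivAt innerProfileDeriv (innerProfileDerivTwo r) r := by
  refine (((((hasDerivAt_pow 2 r).const_mul (699111 / 1562500000 : ℝ)).const_sub
    (855361 / 625000 : ℝ)).const_mul (-4)).fun_mul
      ((hasDerivAt_id r).const_mul (699111 / 1562500000 : ℝ))).congr_deriv ?_
  simp [innerProfileDerivTwo]
  ring

theorem hasDerivAt_inv_pow (n : ℕ) {r : ℝ} (hr : r ≠ 0) :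
    HasDerivAt (fun r : ℝ => r⁻¹ ^ n) (-(n * r⁻¹ ^ (n + 1))) r := by
  refine ((hasDerivAt_inv hr).fun_pow n).congr_deriv ?_
  rcases n with _ | n
  · simp
  · rw [← inv_pow, Nat.add_sub_cancel]
    ring

theorem hasDerivAt_outerProfile {r : ℝ} (hr : r ≠ 0) :
    HasDerivAt outerProfile (outerProfileDeriv r) r := by
  refine (((hasDerivAt_inv_pow 2 hr).fun_add ((hasDerivAt_inv_pow 4 hr).const_mul 10)).fun_add
    ((hasDerivAt_inv_pow 18 hr).const_mul (77623 / 1250000 * 2500 ^ 9))).congr_deriv ?_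
  simp only [outerProfileDeriv]
  push_cast
  ring

theorem hasDerivAt_outerProfileDeriv {r : ℝ} (hr : r ≠ 0) :
    HasDerivAt outerProfileDeriv (outerProfileDerivTwo r) r := by
  refine ((((hasDerivAt_inv_pow 3 hr).const_mul 2).fun_add
    ((hasDerivAt_inv_pow 5 hr).const_mul 40)).fun_add
    ((hasDerivAt_inv_pow 19 hr).const_mul
      (18 * (77623 / 1250000 * 2500 ^ 9)))).fun_neg.congr_deriv ?_
  simp only [outerProfileDerivTwo]
  push_cast
  ring

/-- The inner profile up to `r = 50`, the outer profile from there on. -/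
noncomputable def gluedProfile (r : ℝ) : ℝ := if r ≤ 50 then innerProfile r else outerProfile r

theorem innerProfile_eq_outerProfile : innerProfile 50 = outerProfile 50 := by
  norm_num [innerProfile, outerProfile]

theorem contDiffOn_gluedProfile : ContDiffOn ℝ 1 gluedProfile (Set.Ioi 0) := by
  refine contDiffOn_one_ite_le isOpen_Ioi (fun r _ => hasDerivAt_innerProfile r)
    (fun r hr => hasDerivAt_outerProfile (ne_of_gt hr))
    (fun r _ => (hasDerivAt_innerProfileDeriv r).continuousAt.continuousWithinAt)
    (fun r hr => (hasDerivAt_outerProfileDeriv (ne_of_gt hr)).continuousAt.continuousWithinAt)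
    innerProfile_eq_outerProfile ?_
  norm_num [innerProfileDeriv, outerProfileDeriv]

theorem contDiffAt_gluedProfile {r : ℝ} (hr : 0 < r) (hr' : r ≠ 50) :
    ContDiffAt ℝ 2 gluedProfile r := by
  rcases hr'.lt_or_gt with h | h
  · refine ContDiffAt.congr_of_eventuallyEq (f := innerProfile) ?_ ?_
    · unfold innerProfile
      fun_prop
    · filter_upwards [Iio_mem_nhds h] with y hy
      exact if_pos (le_of_lt hy)
  · refine ContDiffAt.congr_of_eventuallyEq (f := outerProfile) ?_ ?_
    · have := contDiffAt_inv ℝ (n := 2) hr.ne'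
      unfold outerProfile
      fun_prop
    · filter_upwards [Ioi_mem_nhds h] with y hy
      exact if_neg (not_le.2 hy)

end Profiles

section Inequalities

theorem outer_polynomial_le {e R U : ℝ} (he : 0 < e) (he' : e ≤ 1 / 10 ^ 26) (hR : 0 < R)
    (hRb : R ≤ 1 / 2500) (hU : U = 77623 / 1250000 * 2500 ^ 9 * R ^ 8) :
    -16 * R ^ 2 + 200 * R ^ 3 + 1400 * R ^ 4
      + U * R * (-16 + 196 * (U * R) + 328 * R + 3080 * R ^ 2)
      - (e + 19 / 2 * e ^ 2) * (2 + 4 * R + 200 * R ^ 2 + 356 * (U * R))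
      - 2 * (e + 19 / 2 * e ^ 2) ^ 2 + 2 * e * (1 + 20 * R + 9 * U)
      ≤ -(e * R + R ^ 2) / 8 := by
  have hU0 : 0 ≤ U := by rw [hU]; positivity
  have hUR : U * R ≤ 77623 / 1250000 := by
    have h : R ^ 9 ≤ (1 / 2500) ^ 9 := pow_le_pow_left₀ hR.le hRb 9
    calc U * R = 77623 / 1250000 * 2500 ^ 9 * R ^ 9 := by rw [hU]; ring
      _ ≤ 77623 / 1250000 * 2500 ^ 9 * (1 / 2500) ^ 9 := by gcongr
      _ = 77623 / 1250000 := by norm_num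
  have hRR : R ^ 2 ≤ (1 / 2500) ^ 2 := pow_le_pow_left₀ hR.le hRb 2
  have hbracket : U * R * (-16 + 196 * (U * R) + 328 * R + 3080 * R ^ 2) ≤ U * R * (-3.6) := by
    gcongr
    norm_num at hRR ⊢
    linarith
  have hfast : U * R * (-3.6) + 18 * e * U ≤ e ^ 2 / 100 := by
    rcases le_or_gt (5 * e) R with h | h
    · nlinarith [mul_nonneg hU0 (sub_nonneg.2 h), sq_nonneg e]
    · have h1 : R ^ 8 ≤ (5 * e) ^ 8 := pow_le_pow_left₀ hR.le h.le 8
      have h2 : e ^ 7 ≤ (1 / 10 ^ 26) ^ 7 := pow_le_pow_left₀ he.le he' 7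
      have h3 : 0 ≤ U * R := by positivity
      calc U * R * (-3.6) + 18 * e * U ≤ 18 * e * U := by linarith
        _ ≤ 18 * e * (77623 / 1250000 * 2500 ^ 9 * (5 * e) ^ 8) := by rw [hU]; gcongr
        _ = e ^ 2 * (18 * (77623 / 1250000 * 2500 ^ 9 * 5 ^ 8) * e ^ 7) := by ring
        _ ≤ e ^ 2 * (18 * (77623 / 1250000 * 2500 ^ 9 * 5 ^ 8) * (1 / 10 ^ 26) ^ 7) := by gcongr
        _ ≤ e ^ 2 / 100 := by norm_num; linarith [sq_nonneg e]
  have hcubic : 200 * R ^ 3 + 1400 * R ^ 4 ≤ 0.085 * R ^ 2 := by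
    have : R ^ 2 * (200 * R + 1400 * R ^ 2) ≤ R ^ 2 * 0.085 := by
      gcongr
      norm_num at hRR ⊢
      linarith
    linarith
  have hshift : (e + 19 / 2 * e ^ 2) * (2 + 4 * R) ≤
      (e + 19 / 2 * e ^ 2) * (2 + 4 * R + 200 * R ^ 2 + 356 * (U * R)) := by
    have : 0 ≤ U * R := by positivity
    refine mul_le_mul_of_nonneg_left ?_ (by positivity)
    linarith [sq_nonneg R]
  have hsq : 2 * e ^ 2 ≤ 2 * (e + 19 / 2 * e ^ 2) ^ 2 := by
    gcongr
    linarith [sq_nonneg e]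
  have hquad : -15.79 * R ^ 2 + 36.125 * (e * R) - 20.99 * e ^ 2 ≤ 0 := by
    nlinarith [sq_nonneg (R - 1.1439 * e), sq_nonneg e]
  have : 0 ≤ e ^ 2 * R := by positivity
  linarith

theorem barrierOperator_outerProfile_le {a x : ℝ} (ha : 10 ^ 13 ≤ a) (hx : 50 ≤ a * x) :
    barrierOperator x (outerProfile (a * x) - (a⁻¹ ^ 2 + 19 / 2 * a⁻¹ ^ 4))
      (a * outerProfileDeriv (a * x)) (a ^ 2 * outerProfileDerivTwo (a * x)) ≤
      -(((a * x)⁻¹ ^ 4 + a ^ 2 * (a * x)⁻¹ ^ 6) / 8) := by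
  have ha0 : 0 < a := lt_of_lt_of_le (by norm_num) ha
  obtain ⟨ρ, hρ⟩ : ∃ ρ, ρ = (a * x)⁻¹ := ⟨_, rfl⟩
  have hρ0 : 0 < ρ := by rw [hρ]; exact inv_pos.2 (by linarith)
  have hρb : ρ ≤ 1 / 50 := by
    rw [hρ, ← one_div]
    exact one_div_le_one_div_of_le (by norm_num) hx
  have hxρ : x = (a * ρ)⁻¹ := by rw [hρ]; field_simp
  have he : a⁻¹ ^ 2 ≤ 1 / 10 ^ 26 := by
    rw [show (1 : ℝ) / 10 ^ 26 = ((10 ^ 13)⁻¹) ^ 2 by norm_num]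
    gcongr
  have hb : ρ ^ 2 ≤ 1 / 2500 := by
    rw [show (1 : ℝ) / 2500 = (1 / 50) ^ 2 by norm_num]
    gcongr
  have key := outer_polynomial_le (by positivity) he (pow_pos hρ0 2) hb rfl
  have hscale := mul_le_mul_of_nonneg_left key (by positivity : 0 ≤ a ^ 2 * ρ ^ 2)
  refine (Eq.trans_le ?_ hscale).trans_eq ?_
  · simp only [barrierOperator, outerProfile, outerProfileDeriv, outerProfileDerivTwo, ← hρ]
    rw [hxρ]
    field_simp
    ring
  · rw [← hρ]
    field_simp

theorem barrierOperator_innerProfile_le {a x : ℝ} (ha : 10 ^ 13 ≤ a) (hx : 0 < x)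
    (hx' : a * x ≤ 50) :
    barrierOperator x (innerProfile (a * x) - (a⁻¹ ^ 2 + 19 / 2 * a⁻¹ ^ 4))
      (a * innerProfileDeriv (a * x)) (a ^ 2 * innerProfileDerivTwo (a * x)) ≤ -(1 / 2) * a := by
  have ha0 : 0 < a := lt_of_lt_of_le (by norm_num) ha
  obtain ⟨y, hy⟩ : ∃ y : ℝ, y = 855361 / 625000 - 699111 / 1562500000 * (a * x) ^ 2 := ⟨_, rfl⟩
  have hr0 : 0 < a * x := by positivity
  have hr2 : (a * x) ^ 2 ≤ 2500 := by nlinarith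
  have hy1 : 1 / 4 ≤ y := by rw [hy]; linarith
  have hy2 : y ≤ 855361 / 625000 := by rw [hy]; linarith [sq_nonneg (a * x)]
  obtain ⟨e, hee⟩ : ∃ e, e = a⁻¹ := ⟨_, rfl⟩
  have he0 : 0 < e := by rw [hee]; positivity
  have he : e ≤ 1 / 10 ^ 13 := by
    rw [hee, ← one_div]
    exact one_div_le_one_div_of_le (by norm_num) ha
  have hcore : 2 * y * (3 * y - y ^ 3 - 2 * (855361 / 625000)) ≤ -(9 / 25) := by
    have h1 : 3 * y - y ^ 3 ≤ 2 := by
      nlinarith [mul_nonneg (sq_nonneg (y - 1)) (by linarith : 0 ≤ y + 2)]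
    nlinarith
  have hy3 : y ^ 2 ≤ 2 := by nlinarith
  have he2 : e ^ 2 ≤ e / 10 ^ 13 := by nlinarith
  have hσ : 0 ≤ e ^ 2 + 19 / 2 * e ^ 4 := by positivity
  have hσ' : e ^ 2 + 19 / 2 * e ^ 4 ≤ 2 * e := by nlinarith [pow_pos he0 2]
  have hshift : (e ^ 2 + 19 / 2 * e ^ 4) *
      (4 * y ^ 2 - 2 - 8 * (699111 / 1562500000 * (a * x) ^ 2) ^ 2) ≤ 12 * e := by
    calc _ ≤ (e ^ 2 + 19 / 2 * e ^ 4) * 6 := by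
          gcongr
          linarith [sq_nonneg (699111 / 1562500000 * (a * x) ^ 2)]
      _ ≤ 12 * e := by linarith
  have hdrift : 4 * e ^ 2 * (a * x) ^ 2 * y * (699111 / 1562500000 * (a * x) ^ 2) ≤ e := by
    calc _ ≤ 4 * (e / 10 ^ 13) * 2500 * (855361 / 625000) * (699111 / 1562500000 * 2500) := by
          gcongr
      _ ≤ e := by norm_num; linarith
  have key : 2 * y * (3 * y - y ^ 3 - 2 * (855361 / 625000))
      + (e ^ 2 + 19 / 2 * e ^ 4) * (4 * y ^ 2 - 2 - 8 * (699111 / 1562500000 * (a * x) ^ 2) ^ 2)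
      - 2 * (e ^ 2 + 19 / 2 * e ^ 4) ^ 2
      + 4 * e ^ 2 * (a * x) ^ 2 * y * (699111 / 1562500000 * (a * x) ^ 2) ≤
      -(1 / 2) * e * (a * x) ^ 2 := by
    have h1 : e * (a * x) ^ 2 ≤ e * 2500 := by gcongr
    have h2 := sq_nonneg (e ^ 2 + 19 / 2 * e ^ 4)
    norm_num at he
    linarith
  have hscale := mul_le_mul_of_nonneg_left key (by positivity : 0 ≤ a ^ 2 / (a * x) ^ 2)
  refine (Eq.trans_le ?_ hscale).trans_eq ?_
  · simp only [barrierOperator, innerProfile, innerProfileDeriv, innerProfileDerivTwo, ← hy, hee]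
    have hq : 855361 / 625000 = y + 699111 / 1562500000 * (a * x) ^ 2 := by rw [hy]; ring
    rw [hq]
    field_simp
    ring
  · rw [hee]
    field_simp

end Inequalities

section Bounds

theorem innerProfile_ge {r : ℝ} (hr : 0 ≤ r) (hr' : r ≤ 50) : 1 / 16 ≤ innerProfile r := by
  have : r ^ 2 ≤ 2500 := by nlinarith
  rw [innerProfile, show (1 : ℝ) / 16 = (1 / 4) ^ 2 by norm_num]
  gcongr
  linarith

theorem gluedProfile_eq_outerProfile {r : ℝ} (hr : 50 ≤ r) : gluedProfile r = outerProfile r := by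
  rcases eq_or_lt_of_le hr with rfl | h
  · exact (if_pos le_rfl).trans innerProfile_eq_outerProfile
  · exact if_neg (not_le.2 h)

theorem outerProfile_le {r M : ℝ} (hr : 50 ≤ M) (hM : M ≤ r) :
    outerProfile r ≤ r⁻¹ ^ 2 * (1 + 10 * M⁻¹ ^ 2 + 77623 / 1250000 * 2500 ^ 9 * M⁻¹ ^ 16) := by
  have hM0 : 0 < M := by linarith
  have hr0 : 0 < r := by linarith
  calc outerProfile r
      = r⁻¹ ^ 2 * (1 + 10 * r⁻¹ ^ 2 + 77623 / 1250000 * 2500 ^ 9 * r⁻¹ ^ 16) := by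
        rw [outerProfile]; ring
    _ ≤ _ := by gcongr

theorem le_outerProfile {r : ℝ} (hr : 0 < r) : r⁻¹ ^ 2 + 10 * r⁻¹ ^ 4 ≤ outerProfile r := by
  rw [outerProfile]
  have : 0 < r⁻¹ := inv_pos.2 hr
  linarith [show 0 ≤ 77623 / 1250000 * 2500 ^ 9 * r⁻¹ ^ 18 by positivity]

/-- Just beyond `x = 1` the shifted expansion stays above the level required of the barrier. -/
theorem shifted_expansion_ge {a x : ℝ} (ha : 10 ^ 13 ≤ a) (hx : 0 < x)
    (hx' : x ≤ 1 + a⁻¹ ^ 2 / 100) :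
    a⁻¹ ^ 4 / 32 ≤ a⁻¹ ^ 2 * (x⁻¹ ^ 2 - 1) + a⁻¹ ^ 4 / 16 ∧
    a⁻¹ ^ 2 * (x⁻¹ ^ 2 - 1) + a⁻¹ ^ 4 / 16 ≤
      (a * x)⁻¹ ^ 2 + 10 * (a * x)⁻¹ ^ 4 - (a⁻¹ ^ 2 + 19 / 2 * a⁻¹ ^ 4) := by
  have ha0 : 0 < a := lt_of_lt_of_le (by norm_num) ha
  obtain ⟨e, hee⟩ : ∃ e, e = a⁻¹ ^ 2 := ⟨_, rfl⟩
  have he0 : 0 < e := by rw [hee]; positivity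
  have he : e ≤ 1 / 100 := by
    rw [hee, show (1 : ℝ) / 100 = (10⁻¹) ^ 2 by norm_num]
    gcongr
    linarith
  obtain ⟨X, hX⟩ : ∃ X, X = x⁻¹ ^ 2 := ⟨_, rfl⟩
  have hXge : 1 - e / 40 ≤ X := by
    have h1 : x⁻¹ ^ 2 * x ^ 2 = 1 := by field_simp
    rw [← hX] at h1
    rw [← hee] at hx'
    have h2 : x ^ 2 ≤ (1 + e / 100) ^ 2 := by gcongr
    have h3 : 0 < X := by rw [hX]; positivity
    have h4 : 1 ≤ X * (1 + e / 100) ^ 2 := h1.symm.trans_le (by gcongr)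
    nlinarith [mul_pos h3 he0]
  have e4 : a⁻¹ ^ 4 = e ^ 2 := by rw [hee]; ring
  rw [mul_inv, mul_pow, mul_pow, show x⁻¹ ^ 4 = X ^ 2 by rw [hX]; ring, e4, ← hee, ← hX]
  constructor
  · nlinarith
  · have h : 1 - e / 20 ≤ X ^ 2 := by nlinarith
    have h' : 0 ≤ e ^ 2 * (10 * X ^ 2 - 19 / 2 - 1 / 16) := by
      apply mul_nonneg (sq_nonneg e)
      linarith
    linarith

end Bounds

/-- Refinement of Brendle's barrier construction (Proposition 2.10). -/
theorem brendle_barrier :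
    ∃ rstar ∈ Set.Ioo (0:ℝ) 1, ∃ N : ℝ, 1 ≤ N ∧ ∃ alo : ℝ, 1 ≤ alo ∧
      ∃ θ ∈ Set.Ioo (0:ℝ) 1, ∃ C : ℝ, 0 < C ∧
    ∀ a : ℝ, alo ≤ a →
      ∃ ψ : ℝ → ℝ, ∃ S : Finset ℝ,
        ContDiffOn ℝ 1 ψ (Set.Icc (rstar * a⁻¹) (1 + a⁻¹ ^ 2 / 100)) ∧
        (∀ x ∈ Set.Icc (rstar * a⁻¹) (1 + a⁻¹ ^ 2 / 100) \ (S : Set ℝ),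
          ContDiffAt ℝ 2 ψ x) ∧
        (∀ x ∈ Set.Icc (rstar * a⁻¹) (1 + a⁻¹ ^ 2 / 100) \ (S : Set ℝ),
          x ∈ Set.Icc (N * a⁻¹) (1 + a⁻¹ ^ 2 / 100) →
          ψ x * deriv (deriv ψ) x - (deriv ψ x) ^ 2 / 2
            + x⁻¹ ^ 2 * (1 - ψ x) * (x * deriv ψ x + 2 * ψ x) - x * deriv ψ x
            ≤ -(1/4) * a⁻¹ ^ 4 * x⁻¹ ^ 5) ∧
        (∀ x ∈ Set.Icc (rstar * a⁻¹) (1 + a⁻¹ ^ 2 / 100) \ (S : Set ℝ),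
          x ∈ Set.Icc (rstar * a⁻¹) (N * a⁻¹) →
          ψ x * deriv (deriv ψ) x - (deriv ψ x) ^ 2 / 2
            + x⁻¹ ^ 2 * (1 - ψ x) * (x * deriv ψ x + 2 * ψ x) - x * deriv ψ x
            ≤ -(1/2) * a) ∧
        (∀ x ∈ Set.Icc (1/10 : ℝ) (1 + a⁻¹ ^ 2 / 100), ψ x ≤ C * a⁻¹ ^ 2) ∧
        (∀ x ∈ Set.Icc (N * a⁻¹) (1 + a⁻¹ ^ 2 / 100), ψ x ≤ 2 * a⁻¹ ^ 2 * x⁻¹ ^ 2) ∧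
        (∀ x ∈ Set.Icc (rstar * a⁻¹) (1 + a⁻¹ ^ 2 / 100), a⁻¹ ^ 4 / 32 ≤ ψ x) ∧
        (∀ x ∈ Set.Icc (1 - θ) (1 + a⁻¹ ^ 2 / 100),
          a⁻¹ ^ 2 * (x⁻¹ ^ 2 - 1) + a⁻¹ ^ 4 / 16 ≤ ψ x) ∧
        (3/2 ≤ ψ (rstar * a⁻¹)) := by
  refine ⟨1 / 2, by norm_num, 100, by norm_num, 10 ^ 13, by norm_num, 1 / 2, by norm_num, 20000,
    by norm_num, fun a ha => ?_⟩
  have ha0 : 0 < a := lt_of_lt_of_le (by norm_num) ha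
  have hinv : a * a⁻¹ = 1 := mul_inv_cancel₀ ha0.ne'
  have hinv0 : 0 < a⁻¹ := inv_pos.2 ha0
  have hinv_le : a⁻¹ ≤ 1 / 10 ^ 13 := by
    rw [← one_div]
    exact one_div_le_one_div_of_le (by norm_num) ha
  have hpos : ∀ x, 1 / 2 * a⁻¹ ≤ x → 0 < x := fun x hx => lt_of_lt_of_le (by positivity) hx
  have hscale : ∀ c x, c * a⁻¹ ≤ x ↔ c ≤ a * x := fun c x => by
    rw [← div_eq_mul_inv, div_le_iff₀ ha0, mul_comm]
  have hscale' : ∀ c x, x ≤ c * a⁻¹ ↔ a * x ≤ c := fun c x => by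
    rw [← div_eq_mul_inv, le_div_iff₀ ha0, mul_comm]
  have hne : ∀ x, x ∉ (({50 * a⁻¹} : Finset ℝ) : Set ℝ) → a * x ≠ 50 := fun x hx h =>
    hx (by simp [← h, mul_comm a x, hinv, mul_assoc])
  have houter : ∀ x, 50 < a * x → _ := fun x hx =>
    (barrierOperator_of_rescaling (ψ := fun x => gluedProfile (a * x)
      - (a⁻¹ ^ 2 + 19 / 2 * a⁻¹ ^ 4)) isOpen_Ioi hx
      (fun r hr => hasDerivAt_outerProfile (lt_trans (by norm_num) hr).ne')
      (fun r hr => hasDerivAt_outerProfileDeriv (lt_trans (by norm_num) hr).ne')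
      (fun y hy => by simp only [gluedProfile_eq_outerProfile (le_of_lt hy)])).trans_le
      (barrierOperator_outerProfile_le ha hx.le)
  have hinner : ∀ x, 0 < x → a * x < 50 → _ := fun x hx0 hx =>
    (barrierOperator_of_rescaling (ψ := fun x => gluedProfile (a * x)
      - (a⁻¹ ^ 2 + 19 / 2 * a⁻¹ ^ 4)) isOpen_Iio hx
      (fun r _ => hasDerivAt_innerProfile r) (fun r _ => hasDerivAt_innerProfileDeriv r)
      (fun y hy => by simp only [gluedProfile, if_pos (Set.mem_Iio.1 hy).le])).trans_le
      (barrierOperator_innerProfile_le ha hx0 hx.le)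
  have hσ0 : 0 < a⁻¹ ^ 2 + 19 / 2 * a⁻¹ ^ 4 := by positivity
  have hσ : a⁻¹ ^ 2 + 19 / 2 * a⁻¹ ^ 4 ≤ 1 / 50 := by
    calc _ ≤ ((1 : ℝ) / 10 ^ 13) ^ 2 + 19 / 2 * (1 / 10 ^ 13) ^ 4 := by gcongr
      _ ≤ 1 / 50 := by norm_num
  refine ⟨fun x => gluedProfile (a * x) - (a⁻¹ ^ 2 + 19 / 2 * a⁻¹ ^ 4), {50 * a⁻¹},
    ?_, ?_, ?_, ?_, ?_, ?_, ?_, ?_, ?_⟩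
  · refine (contDiffOn_gluedProfile.comp (by fun_prop) fun x hx => ?_).sub contDiffOn_const
    exact mul_pos ha0 (hpos x hx.1)
  · rintro x ⟨hx, hxS⟩
    exact ((contDiffAt_gluedProfile (mul_pos ha0 (hpos x hx.1)) (hne x hxS)).comp x
      (by fun_prop)).sub contDiffAt_const
  · rintro x - ⟨hx, -⟩
    rw [hscale] at hx
    refine (houter x (by linarith)).trans ?_
    have hx0 : 0 < x := pos_of_mul_pos_right (by linarith : 0 < a * x) ha0.le
    obtain ⟨ρ, hρ⟩ : ∃ ρ, ρ = (a * x)⁻¹ := ⟨_, rfl⟩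
    have hxρ : x⁻¹ = a * ρ := by rw [hρ]; field_simp
    have h5 : a⁻¹ ^ 4 * x⁻¹ ^ 5 = a * ρ ^ 5 := by rw [hxρ]; field_simp
    rw [← hρ, mul_assoc, h5]
    nlinarith [sq_nonneg (ρ ^ 2 - a * ρ ^ 3)]
  · rintro x ⟨hx, hxS⟩ ⟨hx1, hx2⟩
    rcases (hne x hxS).lt_or_gt with h | h
    · exact hinner x (hpos x hx1) h
    · refine (houter x h).trans ?_
      rw [hscale'] at hx2
      have h1 : (1 / 100 : ℝ) ≤ (a * x)⁻¹ := by
        rw [← one_div]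
        exact one_div_le_one_div_of_le (by linarith) hx2
      have h4 : 0 ≤ (a * x)⁻¹ ^ 4 := by positivity
      have h6 : a ^ 2 * (1 / 100) ^ 6 ≤ a ^ 2 * (a * x)⁻¹ ^ 6 := by gcongr
      nlinarith
  · rintro x ⟨hx, -⟩
    have hr : 50 ≤ a * x := by nlinarith
    have hx0 : 0 < x := by linarith
    have hx10 : x⁻¹ ≤ 10 := by
      rw [inv_le_comm₀ hx0 (by norm_num)]
      linarith
    simp only [gluedProfile_eq_outerProfile hr]
    calc _ ≤ outerProfile (a * x) := by linarith
      _ ≤ _ := outerProfile_le le_rfl hr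
      _ = a⁻¹ ^ 2 * (x⁻¹ ^ 2 * (1 + 10 * 50⁻¹ ^ 2 + 77623 / 1250000 * 2500 ^ 9 * 50⁻¹ ^ 16)) := by
        rw [mul_inv, mul_pow, mul_assoc]
      _ ≤ a⁻¹ ^ 2 * (10 ^ 2 * (1 + 10 * 50⁻¹ ^ 2 + 77623 / 1250000 * 2500 ^ 9 * 50⁻¹ ^ 16)) := by
        gcongr
      _ ≤ 20000 * a⁻¹ ^ 2 := by
        rw [mul_comm (20000 : ℝ)]
        gcongr
        norm_num
  · rintro x ⟨hx, -⟩
    rw [hscale] at hx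
    simp only [gluedProfile_eq_outerProfile (by linarith : 50 ≤ a * x)]
    calc _ ≤ outerProfile (a * x) := by linarith
      _ ≤ _ := outerProfile_le (by norm_num) hx
      _ ≤ (a * x)⁻¹ ^ 2 * 2 := by
        gcongr
        norm_num
      _ = 2 * a⁻¹ ^ 2 * x⁻¹ ^ 2 := by rw [mul_inv]; ring
  · rintro x ⟨hx, hx'⟩
    have hx0 := hpos x hx
    rcases le_total (a * x) 50 with h | h
    · have h1 := innerProfile_ge (mul_pos ha0 hx0).le h
      simp only [gluedProfile, if_pos h]
      linarith [pow_pos hinv0 2, pow_pos hinv0 4]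
    · have h1 := shifted_expansion_ge ha hx0 hx'
      have h2 := le_outerProfile (mul_pos ha0 hx0)
      simp only [gluedProfile_eq_outerProfile h]
      linarith
  · rintro x ⟨hx, hx'⟩
    have hx0 : 0 < x := by linarith
    have hr : 50 ≤ a * x := by nlinarith
    have h1 := shifted_expansion_ge ha hx0 hx'
    have h2 := le_outerProfile (mul_pos ha0 hx0)
    simp only [gluedProfile_eq_outerProfile hr]
    linarith
  · have h : a * (1 / 2 * a⁻¹) = 1 / 2 := by linarith
    simp only [h, gluedProfile, innerProfile]
    norm_num at hσ ⊢
    linarith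
end

section
/- Let C₀ ≥ 0, s₁ < s₂, and let ρ₁, ρ₂ : [s₁, s₂] → (0, ∞) be continuous with ρ₁(s) < ρ₂(s) for all s. Set Ω := {(r, s) : s ∈ [s₁, s₂], ρ₁(s) ≤ r ≤ ρ₂(s)}. Let u, Ψ : Ω → [0, ∞) be continuous, continuously differentiable in s, and twice continuously differentiable in r, and suppose that on all of Ω: −∂_su ≤ u·∂_r²u − ½·(∂_ru)² + r⁻²·(1 − u)·(r·∂_ru + 2u) + C₀·u^{1/2}·r⁻⁴, and −∂_sΨ > Ψ·∂_r²Ψ − ½·(∂_rΨ)² + r⁻²·(1 − Ψ)·(r·∂_rΨ + 2Ψ) + 2·C₀·Ψ^{1/2}·r⁻⁴. Assume u(r, s) < Ψ(r, s) whenever r = ρ₁(s) or r = ρ₂(s), and u(r, s₂) ≤ Ψ(r, s₂) for all r ∈ [ρ₁(s₂), ρ₂(s₂)]. Then u ≤ Ψ on all of Ω. -/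
section

open Set Filter Topology

lemma ContDiffAt.deriv_of_two {f : ℝ → ℝ} {x : ℝ} (hf : ContDiffAt ℝ 2 f x) :
    ContDiffAt ℝ 1 (deriv f) x := by
  have h : ContDiffAt ℝ 1 (fderiv ℝ f) x := hf.fderiv_right (by norm_num)
  have h' : deriv f = fun y => fderiv ℝ f y 1 := by
    ext y
    exact (fderiv_apply_one_eq_deriv).symm
  rw [h']
  exact h.clm_apply contDiffAt_const

lemma ContDiffAt.eventually_hasDerivAt {f : ℝ → ℝ} {x : ℝ} (hf : ContDiffAt ℝ 2 f x) :
    ∀ᶠ y in 𝓝 x, HasDerivAt f (deriv f y) y := by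
  filter_upwards [hf.eventually (by simp)] with y hy
  exact (hy.differentiableAt (by norm_num)).hasDerivAt

lemma ContDiffAt.hasDerivAt_deriv {f : ℝ → ℝ} {x : ℝ} (hf : ContDiffAt ℝ 2 f x) :
    HasDerivAt (deriv f) (deriv (deriv f) x) x :=
  (hf.deriv_of_two.differentiableAt (by norm_num)).hasDerivAt

/-- The second-order necessary condition at a local maximum. -/
lemma IsLocalMax.second_derivative_nonpos {g g' : ℝ → ℝ} {a c : ℝ} (hmax : IsLocalMax g a)
    (hg : ∀ᶠ t in 𝓝 a, HasDerivAt g (g' t) t) (hg' : HasDerivAt g' c a) :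
    g' a = 0 ∧ c ≤ 0 := by
  have h0 : g' a = 0 := hmax.hasDerivAt_eq_zero hg.self_of_nhds
  refine ⟨h0, ?_⟩
  by_contra! hc
  have hd : deriv g =ᶠ[𝓝 a] g' := hg.mono fun t ht => ht.deriv
  have hdd : deriv (deriv g) a = c := by rw [hd.deriv_eq]; exact hg'.deriv
  have hmin : IsLocalMin g a := isLocalMin_of_deriv_deriv_pos (by rw [hdd]; exact hc)
    (by rw [hd.self_of_nhds, h0]) hg.self_of_nhds.continuousAt
  have hconst : g =ᶠ[𝓝 a] fun _ => g a := by
    filter_upwards [hmax, hmin] with t h1 h2 using le_antisymm h1 h2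
  have : deriv (deriv g) a = 0 := by
    rw [hconst.deriv.deriv_eq]
    simp
  linarith

/-- First- and second-order conditions where `f x - g y` touches
`e * √(ε ^ 2 + m ^ 2 * (x - y) ^ 2)` from below. -/
lemma touching_conditions {f g : ℝ → ℝ} {x y m ε e : ℝ} (hf : ContDiffAt ℝ 2 f x)
    (hg : ContDiffAt ℝ 2 g y) (hε : 0 < ε) (hm : 0 ≤ m) (he : 0 ≤ e)
    (hloc : ∀ᶠ q : ℝ × ℝ in 𝓝 (x, y),
      f q.1 - g q.2 ≤ e * √(ε ^ 2 + m ^ 2 * (q.1 - q.2) ^ 2))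
    (heq : f x - g y = e * √(ε ^ 2 + m ^ 2 * (x - y) ^ 2)) :
    deriv f x = deriv g y ∧ |deriv f x| ≤ e * m ∧ ∀ ξ η : ℝ,
      ξ ^ 2 * deriv (deriv f) x - η ^ 2 * deriv (deriv g) y
        ≤ e * m ^ 2 / √(ε ^ 2 + m ^ 2 * (x - y) ^ 2) * (ξ - η) ^ 2 := by
  set ψ := √(ε ^ 2 + m ^ 2 * (x - y) ^ 2) with hψ
  have hψpos : 0 < ψ := Real.sqrt_pos.2 (by positivity)
  have hψsq : ψ ^ 2 = ε ^ 2 + m ^ 2 * (x - y) ^ 2 := Real.sq_sqrt (by positivity)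
  have htangent : ∀ w : ℝ, √(ε ^ 2 + m ^ 2 * w ^ 2) ≤
      ψ + m ^ 2 * (w ^ 2 - (x - y) ^ 2) / (2 * ψ) := by
    intro w
    set A := √(ε ^ 2 + m ^ 2 * w ^ 2)
    have hA : A ^ 2 = ε ^ 2 + m ^ 2 * w ^ 2 := Real.sq_sqrt (by positivity)
    have : ψ + m ^ 2 * (w ^ 2 - (x - y) ^ 2) / (2 * ψ) - A = (A - ψ) ^ 2 / (2 * ψ) := by
      field_simp
      linear_combination -hA + hψsq
    have : 0 ≤ (A - ψ) ^ 2 / (2 * ψ) := by positivity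
    linarith
  have key : ∀ ξ η : ℝ,
      ξ * deriv f x - η * deriv g y - e * m ^ 2 / ψ * ((x - y) * (ξ - η)) = 0 ∧
      ξ ^ 2 * deriv (deriv f) x - η ^ 2 * deriv (deriv g) y
        - e * m ^ 2 / ψ * (ξ - η) ^ 2 ≤ 0 := by
    intro ξ η
    have hlx : ∀ t : ℝ, HasDerivAt (fun t => x + ξ * t) ξ t := fun t => by
      simpa using ((hasDerivAt_id t).const_mul ξ).const_add x
    have hly : ∀ t : ℝ, HasDerivAt (fun t => y + η * t) η t := fun t => by
      simpa using ((hasDerivAt_id t).const_mul η).const_add y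
    have hlw : ∀ t : ℝ, HasDerivAt (fun t => x - y + (ξ - η) * t) (ξ - η) t := fun t => by
      simpa using ((hasDerivAt_id t).const_mul (ξ - η)).const_add (x - y)
    have htx : Tendsto (fun t => x + ξ * t) (𝓝 0) (𝓝 x) := by
      simpa using (hlx 0).continuousAt.tendsto
    have hty : Tendsto (fun t => y + η * t) (𝓝 0) (𝓝 y) := by
      simpa using (hly 0).continuousAt.tendsto
    have hmax : IsLocalMax (fun t => f (x + ξ * t) - g (y + η * t)
        - e * m ^ 2 / ψ * ((x - y + (ξ - η) * t) ^ 2 / 2)) 0 := by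
      filter_upwards [(htx.prodMk_nhds hty).eventually hloc] with t ht
      have h1 := mul_le_mul_of_nonneg_left (htangent (x + ξ * t - (y + η * t))) he
      have h2 : e * (ψ + m ^ 2 * ((x + ξ * t - (y + η * t)) ^ 2 - (x - y) ^ 2) / (2 * ψ)) =
        e * ψ + e * m ^ 2 / ψ * ((x - y + (ξ - η) * t) ^ 2 / 2)
          - e * m ^ 2 / ψ * ((x - y) ^ 2 / 2) := by
        field_simp
        ring
      simp only [mul_zero, add_zero]
      linarith
    have := hmax.second_derivative_nonpos
      (g' := fun t => ξ * deriv f (x + ξ * t) - η * deriv g (y + η * t)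
        - e * m ^ 2 / ψ * ((x - y + (ξ - η) * t) * (ξ - η)))
      (c := ξ ^ 2 * deriv (deriv f) x - η ^ 2 * deriv (deriv g) y
        - e * m ^ 2 / ψ * (ξ - η) ^ 2) ?_ ?_
    · simpa using this
    · filter_upwards [htx.eventually hf.eventually_hasDerivAt,
        hty.eventually hg.eventually_hasDerivAt] with t h1 h2
      have h3 := ((h1.comp t (hlx t)).sub (h2.comp t (hly t))).sub
        ((((hlw t).pow 2).div_const 2).const_mul (e * m ^ 2 / ψ))
      refine h3.congr_deriv ?_
      push_cast
      ring
    · have h1 : HasDerivAt (deriv f) (deriv (deriv f) x) (x + ξ * 0) := by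
        simpa using hf.hasDerivAt_deriv
      have h2 : HasDerivAt (deriv g) (deriv (deriv g) y) (y + η * 0) := by
        simpa using hg.hasDerivAt_deriv
      have h3 := (((h1.comp 0 (hlx 0)).const_mul ξ).sub ((h2.comp 0 (hly 0)).const_mul η)).sub
        (((hlw 0).mul_const (ξ - η)).const_mul (e * m ^ 2 / ψ))
      refine h3.congr_deriv ?_
      ring
  have hfx : deriv f x = e * m ^ 2 / ψ * (x - y) := by
    have := (key 1 0).1
    simp only [one_mul, zero_mul, sub_zero, mul_one] at this
    linarith
  have hgy : deriv g y = e * m ^ 2 / ψ * (x - y) := by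
    have := (key 0 1).1
    simp only [one_mul, zero_mul, zero_sub] at this
    linarith
  refine ⟨hfx.trans hgy.symm, ?_, fun ξ η => by linarith [(key ξ η).2]⟩
  have hz : m * |x - y| ≤ ψ := by
    refine abs_le_of_sq_le_sq' ?_ hψpos.le |>.2
    rw [mul_pow, sq_abs, hψsq]
    nlinarith
  have : |deriv f x| = e * m * (m * |x - y| / ψ) := by
    rw [hfx, abs_mul, abs_of_nonneg (by positivity)]
    ring
  rw [this]
  exact mul_le_of_le_one_right (by positivity) ((div_le_one hψpos).2 hz)

lemma ContDiffAt.derivs_eq_of_sqrt {f : ℝ → ℝ} {x : ℝ} (hf : ContDiffAt ℝ 2 f x)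
    (hx : 0 < f x) :
    deriv f x = 2 * √(f x) * deriv (fun y => √(f y)) x ∧
    deriv (deriv f) x = 2 * deriv (fun y => √(f y)) x ^ 2
      + 2 * √(f x) * deriv (deriv fun y => √(f y)) x := by
  have hv : ContDiffAt ℝ 2 (fun y => √(f y)) x := hf.sqrt hx.ne'
  have h1 : deriv f =ᶠ[𝓝 x] fun y => 2 * √(f y) * deriv (fun y => √(f y)) y := by
    have hpos : ∀ᶠ y in 𝓝 x, 0 < f y := hf.continuousAt.eventually_const_lt hx
    filter_upwards [hv.eventually_hasDerivAt, hpos.eventually_nhds] with y hy hy'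
    have h2 : (fun y => √(f y) ^ 2) =ᶠ[𝓝 y] f := hy'.mono fun t ht => Real.sq_sqrt ht.le
    rw [← h2.deriv_eq]
    refine ((hy.pow 2).congr_deriv ?_).deriv
    push_cast
    ring
  refine ⟨h1.self_of_nhds, ?_⟩
  rw [h1.deriv_eq]
  refine (((hv.eventually_hasDerivAt.self_of_nhds.const_mul 2).mul
    hv.hasDerivAt_deriv).congr_deriv ?_).deriv
  ring

/-- The square root of a nonnegative `C²` function which is positive at the end points is
Lipschitz. -/
lemma exists_sqrt_le_sqrt_add_mul_abs {f : ℝ → ℝ} {a b : ℝ} (hab : a ≤ b)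
    (hf : ∀ x ∈ Icc a b, ContDiffAt ℝ 2 f x) (hnonneg : ∀ x ∈ Icc a b, 0 ≤ f x)
    (ha : 0 < f a) (hb : 0 < f b) :
    ∃ L > 0, ∀ x ∈ Icc a b, ∀ y ∈ Icc a b, √(f x) ≤ √(f y) + L * |x - y| := by
  have extend : ∀ c ∈ Icc a b, 0 < f c → ∃ d > 0, ∀ x, |x - c| ≤ d →
      ContDiffAt ℝ 2 f x ∧ 0 ≤ f x := by
    intro c hc hfc
    have h := ((hf c hc).eventually (by simp)).and
      ((hf c hc).continuousAt.eventually_const_lt hfc)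
    obtain ⟨d, hd, h⟩ := Metric.eventually_nhds_iff.1 h
    refine ⟨d / 2, by positivity, fun x hx => ?_⟩
    have := @h x (by rw [Real.dist_eq]; linarith)
    exact ⟨this.1, this.2.le⟩
  obtain ⟨d₁, hd₁, h₁⟩ := extend a (left_mem_Icc.2 hab) ha
  obtain ⟨d₂, hd₂, h₂⟩ := extend b (right_mem_Icc.2 hab) hb
  set d := min d₁ d₂
  have hd : 0 < d := lt_min hd₁ hd₂
  have hdd₁ : d ≤ d₁ := min_le_left _ _
  have hdd₂ : d ≤ d₂ := min_le_right _ _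
  set J := Icc (a - d) (b + d)
  have hJ : ∀ x ∈ J, ContDiffAt ℝ 2 f x ∧ 0 ≤ f x := by
    intro x hx
    rcases lt_or_ge x a with hxa | hxa
    · exact h₁ x (by rw [abs_le]; constructor <;> linarith [hx.1])
    rcases lt_or_ge b x with hxb | hxb
    · exact h₂ x (by rw [abs_le]; constructor <;> linarith [hx.2])
    · exact ⟨hf x ⟨hxa, hxb⟩, hnonneg x ⟨hxa, hxb⟩⟩
  have hsub : Icc a b ⊆ J := Icc_subset_Icc (by linarith) (by linarith)
  obtain ⟨D, hD⟩ := isCompact_Icc.exists_bound_of_continuousOn (s := J) (f := deriv f)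
    fun x hx => (hJ x hx).1.deriv_of_two.continuousAt.continuousWithinAt
  obtain ⟨K, hK⟩ := ContDiffOn.exists_lipschitzOnWith (s := J) (f := deriv f) (n := 1)
    (fun x hx => (hJ x hx).1.deriv_of_two.contDiffWithinAt) (by norm_num) (convex_Icc _ _)
    isCompact_Icc
  have hD0 : 0 ≤ D := (norm_nonneg _).trans (hD a (hsub (left_mem_Icc.2 hab)))
  have taylor : ∀ x ∈ J, ∀ y ∈ J, f x ≤ f y + deriv f y * (x - y) + K * (x - y) ^ 2 := by
    intro x hx y hy
    have huI : uIcc y x ⊆ J := uIcc_subset_Icc hy hx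
    have hmv := (convex_uIcc y x).norm_image_sub_le_of_norm_hasDerivWithin_le
      (f := fun t => f t - deriv f y * t) (f' := fun t => deriv f t - deriv f y * 1)
      (C := K * |x - y|) (fun t ht => by
        exact ((((hJ t (huI ht)).1.differentiableAt (by norm_num)).hasDerivAt).sub
          ((hasDerivAt_id t).const_mul _)).hasDerivWithinAt) (fun t ht => by
        have h1 := hK.dist_le_mul t (huI ht) y hy
        rw [Real.dist_eq, Real.dist_eq] at h1
        rw [Real.norm_eq_abs, mul_one]
        exact h1.trans (mul_le_mul_of_nonneg_left (abs_sub_left_of_mem_uIcc ht) K.2)) left_mem_uIcc right_mem_uIcc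
    rw [Real.norm_eq_abs, Real.norm_eq_abs] at hmv
    have := (le_abs_self _).trans hmv
    have h2 : K * |x - y| * |x - y| = K * (x - y) ^ 2 := by rw [mul_assoc, abs_mul_abs_self]; ring
    linarith
  set κ := min (d / (D + 1)) (1 / (2 * K + 1))
  have hκ : 0 < κ := lt_min (by positivity) (by positivity)
  have hκd : κ * D ≤ d := by
    have : κ * (D + 1) ≤ d := (le_div_iff₀ (by positivity)).1 (min_le_left _ _)
    linarith
  have hκK : κ * (2 * K + 1) ≤ 1 := (le_div_iff₀ (by positivity)).1 (min_le_right _ _)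
  have hgrad : ∀ x ∈ Icc a b, κ * deriv f x ^ 2 ≤ 2 * f x := by
    intro x hx
    have hDx : |deriv f x| ≤ D := hD x (hsub hx)
    have hstep : |κ * deriv f x| ≤ d := by
      rw [abs_mul, abs_of_pos hκ]
      exact (mul_le_mul_of_nonneg_left hDx hκ.le).trans hκd
    rw [abs_le] at hstep
    have hmem : x - κ * deriv f x ∈ J := ⟨by linarith [hx.1], by linarith [hx.2]⟩
    have h1 := taylor _ hmem x (hsub hx)
    have h2 := (hJ _ hmem).2
    have h3 : 0 ≤ (1 - κ * (2 * K + 1)) * (κ * deriv f x ^ 2) :=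
      mul_nonneg (by linarith) (by positivity)
    have h4 : 0 ≤ κ * κ * deriv f x ^ 2 := by positivity
    nlinarith
  set L := √(1 / κ + K)
  have hLsq : L ^ 2 = 1 / κ + K := Real.sq_sqrt (by positivity)
  have hL : 0 < L := Real.sqrt_pos.2 (by positivity)
  refine ⟨L, hL, fun x hx y hy => ?_⟩
  have hfy := hnonneg y hy
  have hsq : √(f y) ^ 2 = f y := Real.sq_sqrt hfy
  have hder : |deriv f y| ≤ 2 * L * √(f y) := by
    refine abs_le_of_sq_le_sq ?_ (by positivity)
    rw [mul_pow, mul_pow, hsq, hLsq]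
    have h1 : deriv f y ^ 2 ≤ 2 * f y / κ := by
      rw [le_div_iff₀ hκ]; linarith [hgrad y hy]
    have h2 : 2 * f y / κ ≤ 2 ^ 2 * (1 / κ + K) * f y := by
      have : 2 ^ 2 * (1 / κ + K) * f y - 2 * f y / κ = 2 * f y / κ + 4 * K * f y := by ring
      have : 0 ≤ 2 * f y / κ + 4 * K * f y := by positivity
      linarith
    exact h1.trans h2
  refine Real.sqrt_le_iff.2 ⟨by positivity, ?_⟩
  have h1 := taylor x (hsub hx) y (hsub hy)
  have h2 : deriv f y * (x - y) ≤ 2 * L * √(f y) * |x - y| :=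
    (le_abs_self _).trans (by rw [abs_mul]; gcongr)
  have h3 : K * (x - y) ^ 2 ≤ L ^ 2 * |x - y| ^ 2 := by
    rw [sq_abs, hLsq]
    gcongr
    linarith [one_div_pos.2 hκ]
  nlinarith

/-- The domain swept out by the intervals `[ρ₁ s, ρ₂ s]` for `s ∈ [s₁, s₂]`. -/
def movingStrip (s₁ s₂ : ℝ) (ρ₁ ρ₂ : ℝ → ℝ) : Set (ℝ × ℝ) :=
  {p | p.2 ∈ Icc s₁ s₂ ∧ p.1 ∈ Icc (ρ₁ p.2) (ρ₂ p.2)}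

/-- Pairs of points of a moving strip at the same time. -/
def movingSquare (s₁ s₂ : ℝ) (ρ₁ ρ₂ : ℝ → ℝ) : Set (ℝ × ℝ × ℝ) :=
  {q | q.2.2 ∈ Icc s₁ s₂ ∧ q.1 ∈ Icc (ρ₁ q.2.2) (ρ₂ q.2.2) ∧ q.2.1 ∈ Icc (ρ₁ q.2.2) (ρ₂ q.2.2)}

lemma isCompact_movingSquare {s₁ s₂ : ℝ} {ρ₁ ρ₂ : ℝ → ℝ} (h₁ : ContinuousOn ρ₁ (Icc s₁ s₂))
    (h₂ : ContinuousOn ρ₂ (Icc s₁ s₂)) : IsCompact (movingSquare s₁ s₂ ρ₁ ρ₂) := by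
  have hK : IsCompact (Icc (0 : ℝ) 1 ×ˢ Icc (0 : ℝ) 1 ×ˢ Icc s₁ s₂) :=
    isCompact_Icc.prod (isCompact_Icc.prod isCompact_Icc)
  have hmaps : MapsTo (fun q : ℝ × ℝ × ℝ => q.2.2)
      (Icc (0 : ℝ) 1 ×ˢ Icc (0 : ℝ) 1 ×ˢ Icc s₁ s₂) (Icc s₁ s₂) := fun q hq => hq.2.2
  have hc₁ := h₁.comp (by fun_prop) hmaps
  have hc₂ := h₂.comp (by fun_prop) hmaps
  simp only [Function.comp_def] at hc₁ hc₂
  have himage : movingSquare s₁ s₂ ρ₁ ρ₂ ⊆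
      (fun q : ℝ × ℝ × ℝ => (ρ₁ q.2.2 + q.1 * (ρ₂ q.2.2 - ρ₁ q.2.2),
        ρ₁ q.2.2 + q.2.1 * (ρ₂ q.2.2 - ρ₁ q.2.2), q.2.2)) ''
      (Icc (0 : ℝ) 1 ×ˢ Icc (0 : ℝ) 1 ×ˢ Icc s₁ s₂) := by
    rintro ⟨x, y, s⟩ ⟨hs, hx, hy⟩
    have param : ∀ z ∈ Icc (ρ₁ s) (ρ₂ s), ∃ t ∈ Icc (0 : ℝ) 1,
        ρ₁ s + t * (ρ₂ s - ρ₁ s) = z := by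
      intro z hz
      have := (segment_eq_Icc (hz.1.trans hz.2)).symm ▸ hz
      rw [segment_eq_image'] at this
      simpa using this
    obtain ⟨t, ht, htx⟩ := param x hx
    obtain ⟨t', ht', hty⟩ := param y hy
    exact ⟨(t, t', s), ⟨ht, ht', hs⟩, by simp only [htx, hty]⟩
  have hsub : (fun q : ℝ × ℝ × ℝ => (ρ₁ q.2.2 + q.1 * (ρ₂ q.2.2 - ρ₁ q.2.2),
        ρ₁ q.2.2 + q.2.1 * (ρ₂ q.2.2 - ρ₁ q.2.2), q.2.2)) ''
      {q ∈ Icc (0 : ℝ) 1 ×ˢ Icc (0 : ℝ) 1 ×ˢ Icc s₁ s₂ | 0 ≤ ρ₂ q.2.2 - ρ₁ q.2.2}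
      = movingSquare s₁ s₂ ρ₁ ρ₂ := by
    apply Subset.antisymm
    · rintro _ ⟨⟨t, t', s⟩, ⟨⟨ht, ht', hs⟩, hle⟩, rfl⟩
      simp only [mem_Icc] at ht ht' hs hle
      refine ⟨hs, ⟨?_, ?_⟩, ⟨?_, ?_⟩⟩ <;> simp only <;> nlinarith
    · intro q hq
      obtain ⟨q', hq', rfl⟩ := himage hq
      refine ⟨q', ⟨hq', ?_⟩, rfl⟩
      have := hq.2.1.1.trans hq.2.1.2
      simp only at this
      linarith
  rw [← hsub]
  refine IsCompact.image_of_continuousOn ?_ (by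
    refine ContinuousOn.mono (s := Icc (0 : ℝ) 1 ×ˢ Icc (0 : ℝ) 1 ×ˢ Icc s₁ s₂) ?_ (sep_subset _ _)
    fun_prop)
  refine hK.of_isClosed_subset ?_ (sep_subset _ _)
  exact (hc₂.sub hc₁).preimage_isClosed_of_isClosed hK.isClosed isClosed_Ici

/-- The lower-order part of the equation satisfied by the square root of a solution. -/
noncomputable def sqrtReaction (C₀ r v p : ℝ) : ℝ :=
  r⁻¹ ^ 2 * (1 - v ^ 2) * (r * p + v) + C₀ / 2 * r⁻¹ ^ 4

lemma exists_sqrtReaction_sub_le (C₀ R B P : ℝ) {ρ : ℝ} (hρ : 0 < ρ) :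
    ∃ C ≥ 0, ∀ x ∈ Icc ρ R, ∀ y ∈ Icc ρ R, ∀ v ∈ Icc 0 B, ∀ w ∈ Icc 0 B, ∀ p ∈ Icc (-P) P,
      sqrtReaction C₀ x v p - sqrtReaction C₀ y w p ≤ C * (|x - y| + |v - w|) := by
  have hsmooth : ContDiffOn ℝ 1 (fun q : ℝ × ℝ × ℝ => sqrtReaction C₀ q.1 q.2.1 q.2.2)
      (Icc ρ R ×ˢ Icc 0 B ×ˢ Icc (-P) P) := by
    have hinv : ContDiffOn ℝ 1 (fun q : ℝ × ℝ × ℝ => q.1⁻¹)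
        (Icc ρ R ×ˢ Icc 0 B ×ˢ Icc (-P) P) :=
      contDiff_fst.contDiffOn.inv fun q hq => (hρ.trans_le hq.1.1).ne'
    unfold sqrtReaction
    fun_prop
  obtain ⟨K, hK⟩ := hsmooth.exists_lipschitzOnWith (by norm_num)
    ((convex_Icc _ _).prod ((convex_Icc _ _).prod (convex_Icc _ _)))
    (isCompact_Icc.prod (isCompact_Icc.prod isCompact_Icc))
  refine ⟨K, K.2, fun x hx y hy v hv w hw p hp => ?_⟩
  have h := hK.dist_le_mul (x, v, p) ⟨hx, hv, hp⟩ (y, w, p) ⟨hy, hw, hp⟩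
  refine (le_abs_self _).trans (h.trans (mul_le_mul_of_nonneg_left ?_ K.2))
  simp only [Prod.dist_eq, Real.dist_eq, sub_self, abs_zero]
  have h1 := abs_nonneg (x - y)
  have h2 := abs_nonneg (v - w)
  simp only [max_le_iff]
  exact ⟨by linarith, by linarith, by linarith⟩

/-- `u` and `Ψ` are a sub- and a strict supersolution of the backward equation on a moving strip,
ordered on the lateral boundary. -/
structure IsComparisonPair (C₀ s₁ s₂ : ℝ) (ρ₁ ρ₂ : ℝ → ℝ) (u Ψ : ℝ → ℝ → ℝ) : Prop where
  const_nonneg : 0 ≤ C₀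
  left_cont : ContinuousOn ρ₁ (Icc s₁ s₂)
  right_cont : ContinuousOn ρ₂ (Icc s₁ s₂)
  left_pos : ∀ s ∈ Icc s₁ s₂, 0 < ρ₁ s
  left_lt_right : ∀ s ∈ Icc s₁ s₂, ρ₁ s < ρ₂ s
  sub_cont : ContinuousOn (fun p : ℝ × ℝ => u p.1 p.2) (movingStrip s₁ s₂ ρ₁ ρ₂)
  super_cont : ContinuousOn (fun p : ℝ × ℝ => Ψ p.1 p.2) (movingStrip s₁ s₂ ρ₁ ρ₂)
  sub_time : ∀ p ∈ movingStrip s₁ s₂ ρ₁ ρ₂, ContDiffAt ℝ 1 (fun s => u p.1 s) p.2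
  sub_space : ∀ p ∈ movingStrip s₁ s₂ ρ₁ ρ₂, ContDiffAt ℝ 2 (fun r => u r p.2) p.1
  super_time : ∀ p ∈ movingStrip s₁ s₂ ρ₁ ρ₂, ContDiffAt ℝ 1 (fun s => Ψ p.1 s) p.2
  super_space : ∀ p ∈ movingStrip s₁ s₂ ρ₁ ρ₂, ContDiffAt ℝ 2 (fun r => Ψ r p.2) p.1
  sub_nonneg : ∀ p ∈ movingStrip s₁ s₂ ρ₁ ρ₂, 0 ≤ u p.1 p.2
  super_nonneg : ∀ p ∈ movingStrip s₁ s₂ ρ₁ ρ₂, 0 ≤ Ψ p.1 p.2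
  sub_ineq : ∀ p ∈ movingStrip s₁ s₂ ρ₁ ρ₂,
    - deriv (fun s => u p.1 s) p.2
      ≤ u p.1 p.2 * deriv (deriv (fun r => u r p.2)) p.1
        - (1/2) * (deriv (fun r => u r p.2) p.1) ^ 2
        + p.1⁻¹ ^ 2 * (1 - u p.1 p.2)
          * (p.1 * deriv (fun r => u r p.2) p.1 + 2 * u p.1 p.2)
        + C₀ * √(u p.1 p.2) * p.1⁻¹ ^ 4
  super_ineq : ∀ p ∈ movingStrip s₁ s₂ ρ₁ ρ₂,
    - deriv (fun s => Ψ p.1 s) p.2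
      > Ψ p.1 p.2 * deriv (deriv (fun r => Ψ r p.2)) p.1
        - (1/2) * (deriv (fun r => Ψ r p.2) p.1) ^ 2
        + p.1⁻¹ ^ 2 * (1 - Ψ p.1 p.2)
          * (p.1 * deriv (fun r => Ψ r p.2) p.1 + 2 * Ψ p.1 p.2)
        + 2 * C₀ * √(Ψ p.1 p.2) * p.1⁻¹ ^ 4
  boundary : ∀ s ∈ Icc s₁ s₂, u (ρ₁ s) s < Ψ (ρ₁ s) s ∧ u (ρ₂ s) s < Ψ (ρ₂ s) s

/-- A function which is negative to the right of a zero has nonpositive derivative there. -/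
lemma HasDerivAt.nonpos_of_eventually_le {f : ℝ → ℝ} {f' a : ℝ} (hf : HasDerivAt f f' a)
    (h : ∀ᶠ t in 𝓝[>] a, f t ≤ f a) : f' ≤ 0 := by
  refine le_of_tendsto ((hasDerivWithinAt_iff_tendsto_slope' (s := Ioi a) (by simp)).1
    (hf.hasDerivWithinAt (s := Ioi a))) ?_
  filter_upwards [h, self_mem_nhdsWithin] with t ht hta
  rw [slope_def_field]
  exact div_nonpos_of_nonpos_of_nonneg (by linarith) (by linarith [mem_Ioi.1 hta])

namespace IsComparisonPair

variable {C₀ s₁ s₂ : ℝ} {ρ₁ ρ₂ : ℝ → ℝ} {u Ψ : ℝ → ℝ → ℝ}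

lemma restrict (H : IsComparisonPair C₀ s₁ s₂ ρ₁ ρ₂ u Ψ) {t : ℝ} (ht : t ≤ s₂) :
    IsComparisonPair C₀ s₁ t ρ₁ ρ₂ u Ψ := by
  have hI : Icc s₁ t ⊆ Icc s₁ s₂ := Icc_subset_Icc_right ht
  have hS : movingStrip s₁ t ρ₁ ρ₂ ⊆ movingStrip s₁ s₂ ρ₁ ρ₂ := fun p hp => ⟨hI hp.1, hp.2⟩
  exact ⟨H.const_nonneg, H.left_cont.mono hI, H.right_cont.mono hI,
    fun s hs => H.left_pos s (hI hs), fun s hs => H.left_lt_right s (hI hs),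
    H.sub_cont.mono hS, H.super_cont.mono hS, fun p hp => H.sub_time p (hS hp),
    fun p hp => H.sub_space p (hS hp), fun p hp => H.super_time p (hS hp),
    fun p hp => H.super_space p (hS hp), fun p hp => H.sub_nonneg p (hS hp),
    fun p hp => H.super_nonneg p (hS hp), fun p hp => H.sub_ineq p (hS hp),
    fun p hp => H.super_ineq p (hS hp), fun s hs => H.boundary s (hI hs)⟩

lemma eventually_mem_Ioo (H : IsComparisonPair C₀ s₁ s₂ ρ₁ ρ₂ u Ψ) {x s : ℝ}
    (hs : s ∈ Ico s₁ s₂) (hx : x ∈ Ioo (ρ₁ s) (ρ₂ s)) :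
    ∀ᶠ t in 𝓝[>] s, t ∈ Icc s₁ s₂ ∧ x ∈ Ioo (ρ₁ t) (ρ₂ t) := by
  have hIoc : ∀ᶠ t in 𝓝[>] s, t ∈ Icc s₁ s₂ := by
    filter_upwards [Ioc_mem_nhdsGT hs.2] with t ht using ⟨hs.1.trans ht.1.le, ht.2⟩
  have hle : 𝓝[>] s ≤ 𝓝[Icc s₁ s₂] s :=
    le_inf (nhdsWithin_le_nhds) (le_principal_iff.2 hIoc)
  have h₁ := ((H.left_cont s (Ico_subset_Icc_self hs)).mono_left hle).eventually_lt_const hx.1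
  have h₂ := ((H.right_cont s (Ico_subset_Icc_self hs)).mono_left hle).eventually_const_lt hx.2
  filter_upwards [hIoc, h₁, h₂] with t h h1 h2 using ⟨h, h1, h2⟩

lemma super_pos (H : IsComparisonPair C₀ s₁ s₂ ρ₁ ρ₂ u Ψ) {x s : ℝ}
    (hs : s ∈ Ico s₁ s₂) (hx : x ∈ Ioo (ρ₁ s) (ρ₂ s)) : 0 < Ψ x s := by
  have hmem : (x, s) ∈ movingStrip s₁ s₂ ρ₁ ρ₂ :=
    ⟨Ico_subset_Icc_self hs, Ioo_subset_Icc_self hx⟩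
  refine (H.super_nonneg _ hmem).lt_of_ne' fun h0 => ?_
  simp only at h0
  have hmin : IsLocalMin (fun r => Ψ r s) x := by
    filter_upwards [isOpen_Ioo.mem_nhds hx] with r hr
    rw [h0]
    exact H.super_nonneg (r, s) ⟨Ico_subset_Icc_self hs, Ioo_subset_Icc_self hr⟩
  have hineq := H.super_ineq _ hmem
  simp only [h0, hmin.deriv_eq_zero, Real.sqrt_zero] at hineq
  have htime := ((H.super_time _ hmem).differentiableAt (by norm_num)).hasDerivAt
  have := htime.neg.nonpos_of_eventually_le (by
    filter_upwards [H.eventually_mem_Ioo hs hx] with t ht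
    simp only [Pi.neg_apply, h0, neg_zero, neg_nonpos]
    exact H.super_nonneg (x, t) ⟨ht.1, Ioo_subset_Icc_self ht.2⟩)
  simp only at this
  linarith

lemma sub_sqrt_ineq (H : IsComparisonPair C₀ s₁ s₂ ρ₁ ρ₂ u Ψ) {x s : ℝ}
    (hmem : (x, s) ∈ movingStrip s₁ s₂ ρ₁ ρ₂) (hpos : 0 < u x s) :
    - deriv (fun t => √(u x t)) s ≤ √(u x s) ^ 2 * deriv (deriv fun r => √(u r s)) x
      + sqrtReaction C₀ x √(u x s) (deriv (fun r => √(u r s)) x) := by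
  have hineq := H.sub_ineq _ hmem
  obtain ⟨h1, h2⟩ := (H.sub_space _ hmem).derivs_eq_of_sqrt hpos
  have ht := deriv_sqrt ((H.sub_time _ hmem).differentiableAt (by norm_num)) hpos.ne'
  simp only at hineq h1 h2 ht
  have hv : 0 < √(u x s) := Real.sqrt_pos.2 hpos
  have hsq : √(u x s) ^ 2 = u x s := Real.sq_sqrt hpos.le
  rw [h1, h2] at hineq
  rw [ht, sqrtReaction]
  refine le_of_mul_le_mul_left ?_ (mul_pos two_pos hv)
  have e : 2 * √(u x s) * -(deriv (fun t => u x t) s / (2 * √(u x s)))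
      = -deriv (fun t => u x t) s := by field_simp
  rw [e]
  refine hineq.trans_eq ?_
  rw [← hsq, Real.sqrt_sq hv.le]
  ring

lemma super_sqrt_ineq (H : IsComparisonPair C₀ s₁ s₂ ρ₁ ρ₂ u Ψ) {x s : ℝ}
    (hmem : (x, s) ∈ movingStrip s₁ s₂ ρ₁ ρ₂) (hpos : 0 < Ψ x s) :
    √(Ψ x s) ^ 2 * deriv (deriv fun r => √(Ψ r s)) x
      + sqrtReaction C₀ x √(Ψ x s) (deriv (fun r => √(Ψ r s)) x)
      < - deriv (fun t => √(Ψ x t)) s := by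
  have hineq := H.super_ineq _ hmem
  obtain ⟨h1, h2⟩ := (H.super_space _ hmem).derivs_eq_of_sqrt hpos
  have ht := deriv_sqrt ((H.super_time _ hmem).differentiableAt (by norm_num)) hpos.ne'
  simp only at hineq h1 h2 ht
  have hv : 0 < √(Ψ x s) := Real.sqrt_pos.2 hpos
  have hsq : √(Ψ x s) ^ 2 = Ψ x s := Real.sq_sqrt hpos.le
  rw [h1, h2] at hineq
  rw [ht, sqrtReaction]
  refine lt_of_mul_lt_mul_left ?_ (mul_pos two_pos hv).le
  have e : 2 * √(Ψ x s) * -(deriv (fun t => Ψ x t) s / (2 * √(Ψ x s)))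
      = -deriv (fun t => Ψ x t) s := by field_simp
  rw [e]
  refine lt_of_le_of_lt ?_ hineq
  have hC : 0 ≤ C₀ * √(Ψ x s) * x⁻¹ ^ 4 := by
    have := H.const_nonneg
    positivity
  rw [← hsq, Real.sqrt_sq hv.le]
  linarith

/-- Away from the lateral boundary, the penalized difference cannot touch zero from below when
time runs backward. -/
lemma not_touching (H : IsComparisonPair C₀ s₁ s₂ ρ₁ ρ₂ u Ψ) {m Λ C ε x y s : ℝ}
    (hm : 0 < m) (hC : 0 ≤ C) (hΛ : 8 * m ^ 2 + C * (1 / m + 2) ≤ Λ) (hε : 0 < ε)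
    (hs : s ∈ Ico s₁ s₂) (hx : x ∈ Ioo (ρ₁ s) (ρ₂ s)) (hy : y ∈ Ioo (ρ₁ s) (ρ₂ s))
    (hsmall : Λ * (s₂ - s) ≤ 1)
    (hreact : ∀ p ∈ Icc (-(2 * m)) (2 * m),
      sqrtReaction C₀ x √(u x s) p - sqrtReaction C₀ y √(Ψ y s) p
        ≤ C * (|x - y| + |√(u x s) - √(Ψ y s)|))
    (hlater : ∀ x' y' t, t ∈ Ioc s s₂ → x' ∈ Icc (ρ₁ t) (ρ₂ t) → y' ∈ Icc (ρ₁ t) (ρ₂ t) →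
      √(u x' t) - √(Ψ y' t) < (1 + Λ * (s₂ - t)) * √(ε ^ 2 + m ^ 2 * (x' - y') ^ 2)) :
    √(u x s) - √(Ψ y s) < (1 + Λ * (s₂ - s)) * √(ε ^ 2 + m ^ 2 * (x - y) ^ 2) := by
  have hΛ0 : 0 ≤ Λ := le_trans (by positivity) hΛ
  have hsI := Ico_subset_Icc_self hs
  have hmem : ∀ {z}, z ∈ Ioo (ρ₁ s) (ρ₂ s) → (z, s) ∈ movingStrip s₁ s₂ ρ₁ ρ₂ :=
    fun hz => ⟨hsI, Ioo_subset_Icc_self hz⟩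
  have hslice : ∀ x' ∈ Ioo (ρ₁ s) (ρ₂ s), ∀ y' ∈ Ioo (ρ₁ s) (ρ₂ s),
      √(u x' s) - √(Ψ y' s) ≤ (1 + Λ * (s₂ - s)) * √(ε ^ 2 + m ^ 2 * (x' - y') ^ 2) := by
    intro x' hx' y' hy'
    have hcu := (H.sub_time _ (hmem hx')).continuousAt.sqrt
    have hcΨ := (H.super_time _ (hmem hy')).continuousAt.sqrt
    have hlin : ContinuousAt (fun t => (1 + Λ * (s₂ - t)) * √(ε ^ 2 + m ^ 2 * (x' - y') ^ 2)) s := by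
      fun_prop
    refine le_of_tendsto_of_tendsto ((hcu.sub hcΨ).mono_left nhdsWithin_le_nhds)
      (hlin.mono_left nhdsWithin_le_nhds : Tendsto _ (𝓝[>] s) _) ?_
    filter_upwards [H.eventually_mem_Ioo hs hx', H.eventually_mem_Ioo hs hy',
      self_mem_nhdsWithin] with t h1 h2 h3
    exact (hlater x' y' t ⟨h3, h1.1.2⟩ (Ioo_subset_Icc_self h1.2)
      (Ioo_subset_Icc_self h2.2)).le
  refine (hslice x hx y hy).lt_of_ne fun heq => ?_
  set e := 1 + Λ * (s₂ - s)
  set ψ := √(ε ^ 2 + m ^ 2 * (x - y) ^ 2) with hψ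
  have he1 : 1 ≤ e := by
    have := mul_nonneg hΛ0 (_root_.sub_nonneg.2 hs.2.le)
    linarith
  have he2 : e ≤ 2 := by linarith
  have hψpos : 0 < ψ := Real.sqrt_pos.2 (by positivity)
  have hψsq : ψ ^ 2 = ε ^ 2 + m ^ 2 * (x - y) ^ 2 := Real.sq_sqrt (by positivity)
  have hΨpos : 0 < Ψ y s := H.super_pos hs hy
  have hupos : 0 < u x s := by
    refine Real.sqrt_pos.1 ?_
    have := Real.sqrt_pos.2 hΨpos
    have : 0 < e * ψ := by positivity
    linarith
  have hf := (H.sub_space _ (hmem hx)).sqrt hupos.ne'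
  have hg := (H.super_space _ (hmem hy)).sqrt hΨpos.ne'
  simp only at hf hg
  obtain ⟨hp, hpm, hsecond⟩ := touching_conditions hf hg hε hm.le (by linarith : 0 ≤ e)
    (by
      filter_upwards [(isOpen_Ioo.prod isOpen_Ioo).mem_nhds ⟨hx, hy⟩] with q hq
      exact hslice q.1 hq.1 q.2 hq.2) heq
  have hsecond := hsecond √(u x s) √(Ψ y s)
  have hu := H.sub_sqrt_ineq (hmem hx) hupos
  have hΨ := H.super_sqrt_ineq (hmem hy) hΨpos
  have hr := hreact (deriv (fun r => √(u r s)) x) (abs_le.1 (hpm.trans (by gcongr)))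
  rw [← hp] at hΨ
  have hfs := (((H.sub_time _ (hmem hx)).sqrt hupos.ne').differentiableAt
    (by norm_num)).hasDerivAt
  have hgs := (((H.super_time _ (hmem hy)).sqrt hΨpos.ne').differentiableAt
    (by norm_num)).hasDerivAt
  have hlin : HasDerivAt (fun t => (1 + Λ * (s₂ - t)) * ψ) (-(Λ * ψ)) s := by
    have := ((((hasDerivAt_id s).const_sub s₂).const_mul Λ).const_add 1).mul_const ψ
    exact this.congr_deriv (by ring)
  have htime := ((hfs.sub hgs).sub hlin).nonpos_of_eventually_le (by
    filter_upwards [H.eventually_mem_Ioo hs hx, H.eventually_mem_Ioo hs hy,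
      self_mem_nhdsWithin] with t h1 h2 h3
    have := hlater x y t ⟨h3, h1.1.2⟩ (Ioo_subset_Icc_self h1.2) (Ioo_subset_Icc_self h2.2)
    simp only [Pi.sub_apply]
    linarith)
  simp only at htime
  have hz : m * |x - y| ≤ ψ := by
    refine abs_le_of_sq_le_sq' ?_ hψpos.le |>.2
    rw [mul_pow, sq_abs, hψsq]
    nlinarith
  have hz' : |x - y| ≤ 1 / m * ψ := by
    rw [one_div, inv_mul_eq_div, le_div_iff₀ hm]
    linarith
  have hquad : e * m ^ 2 / ψ * (√(u x s) - √(Ψ y s)) ^ 2 ≤ 8 * m ^ 2 * ψ := by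
    rw [heq]
    have h1 : e * m ^ 2 / ψ * (e * ψ) ^ 2 = e ^ 3 * m ^ 2 * ψ := by field_simp
    have h2 : e ^ 3 ≤ 2 ^ 3 := by gcongr
    rw [h1]
    have h3 : 0 ≤ m ^ 2 * ψ := by positivity
    linarith [mul_le_mul_of_nonneg_right h2 h3]
  have hlow : C * (|x - y| + |√(u x s) - √(Ψ y s)|) ≤ C * (1 / m + 2) * ψ := by
    rw [heq, abs_of_pos (mul_pos (by linarith) hψpos), mul_assoc C]
    refine mul_le_mul_of_nonneg_left ?_ hC
    linarith [mul_le_mul_of_nonneg_right he2 hψpos.le]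
  have hΛψ := mul_le_mul_of_nonneg_right hΛ hψpos.le
  linarith

lemma movingSquare_fst {q : ℝ × ℝ × ℝ} (hq : q ∈ movingSquare s₁ s₂ ρ₁ ρ₂) :
    (q.1, q.2.2) ∈ movingStrip s₁ s₂ ρ₁ ρ₂ := ⟨hq.1, hq.2.1⟩

lemma movingSquare_snd {q : ℝ × ℝ × ℝ} (hq : q ∈ movingSquare s₁ s₂ ρ₁ ρ₂) :
    (q.2.1, q.2.2) ∈ movingStrip s₁ s₂ ρ₁ ρ₂ := ⟨hq.1, hq.2.2⟩

lemma continuousOn_sqrt_sub (H : IsComparisonPair C₀ s₁ s₂ ρ₁ ρ₂ u Ψ) :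
    ContinuousOn (fun q : ℝ × ℝ × ℝ => √(u q.1 q.2.2) - √(Ψ q.2.1 q.2.2))
      (movingSquare s₁ s₂ ρ₁ ρ₂) := by
  have hu := H.sub_cont.comp (f := fun q : ℝ × ℝ × ℝ => (q.1, q.2.2)) (by fun_prop)
    fun _ => movingSquare_fst
  have hΨ := H.super_cont.comp (f := fun q : ℝ × ℝ × ℝ => (q.2.1, q.2.2)) (by fun_prop)
    fun _ => movingSquare_snd
  exact hu.sqrt.sub hΨ.sqrt

/-- Just before the final time, the square roots differ by less than `m * |x - y|` whenever one of
the two points lies on the lateral boundary. -/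
lemma exists_boundary_gap (H : IsComparisonPair C₀ s₁ s₂ ρ₁ ρ₂ u Ψ) (hs : s₁ ≤ s₂)
    (hfinal : ∀ r ∈ Icc (ρ₁ s₂) (ρ₂ s₂), u r s₂ ≤ Ψ r s₂) :
    ∃ m > 0, ∃ h > 0,
      (∀ x ∈ Icc (ρ₁ s₂) (ρ₂ s₂), ∀ y ∈ Icc (ρ₁ s₂) (ρ₂ s₂),
        √(u x s₂) - √(Ψ y s₂) ≤ m * |x - y|) ∧
      ∀ q ∈ movingSquare s₁ s₂ ρ₁ ρ₂, s₂ - h ≤ q.2.2 →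
        ¬ (q.1 ∈ Ioo (ρ₁ q.2.2) (ρ₂ q.2.2) ∧ q.2.1 ∈ Ioo (ρ₁ q.2.2) (ρ₂ q.2.2)) →
        √(u q.1 q.2.2) - √(Ψ q.2.1 q.2.2) < m * |q.1 - q.2.1| := by
  have hs₂ : s₂ ∈ Icc s₁ s₂ := right_mem_Icc.2 hs
  have hlt := H.left_lt_right s₂ hs₂
  have hmem : ∀ r ∈ Icc (ρ₁ s₂) (ρ₂ s₂), (r, s₂) ∈ movingStrip s₁ s₂ ρ₁ ρ₂ :=
    fun r hr => ⟨hs₂, hr⟩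
  obtain ⟨L, hL, hlip⟩ := exists_sqrt_le_sqrt_add_mul_abs hlt.le
    (fun r hr => H.super_space _ (hmem r hr)) (fun r hr => H.super_nonneg _ (hmem r hr))
    ((H.sub_nonneg _ (hmem _ (left_mem_Icc.2 hlt.le))).trans_lt (H.boundary s₂ hs₂).1)
    ((H.sub_nonneg _ (hmem _ (right_mem_Icc.2 hlt.le))).trans_lt (H.boundary s₂ hs₂).2)
  have hdiff : ∀ x ∈ Icc (ρ₁ s₂) (ρ₂ s₂), ∀ y ∈ Icc (ρ₁ s₂) (ρ₂ s₂),
      √(u x s₂) - √(Ψ y s₂) ≤ L * |x - y| := fun x hx y hy => by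
    linarith [hlip x hx y hy, Real.sqrt_le_sqrt (hfinal x hx)]
  set T := movingSquare s₁ s₂ ρ₁ ρ₂
  have hT : IsCompact T := isCompact_movingSquare H.left_cont H.right_cont
  have hc₁ := H.left_cont.comp (f := fun q : ℝ × ℝ × ℝ => q.2.2) (s := T) (by fun_prop)
    fun q hq => hq.1
  have hc₂ := H.right_cont.comp (f := fun q : ℝ × ℝ × ℝ => q.2.2) (s := T) (by fun_prop)
    fun q hq => hq.1
  simp only [Function.comp_def] at hc₁ hc₂
  let F : ℝ × ℝ × ℝ → ℝ × ℝ := fun q =>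
    ((q.1 - ρ₁ q.2.2) * (q.1 - ρ₂ q.2.2) * ((q.2.1 - ρ₁ q.2.2) * (q.2.1 - ρ₂ q.2.2)),
      √(u q.1 q.2.2) - √(Ψ q.2.1 q.2.2) - 2 * L * |q.1 - q.2.1|)
  have hF : ContinuousOn F T := by
    have hx : ContinuousOn (fun q : ℝ × ℝ × ℝ => q.1) T := by fun_prop
    have hy : ContinuousOn (fun q : ℝ × ℝ × ℝ => q.2.1) T := by fun_prop
    exact ContinuousOn.prodMk (((hx.sub hc₁).mul (hx.sub hc₂)).mul ((hy.sub hc₁).mul (hy.sub hc₂)))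
      (H.continuousOn_sqrt_sub.sub (by fun_prop))
  have hK : IsCompact (T ∩ F ⁻¹' ({0} ×ˢ Ici 0)) :=
    hT.of_isClosed_subset (hF.preimage_isClosed_of_isClosed hT.isClosed
      (isClosed_singleton.prod isClosed_Ici)) inter_subset_left
  have hbefore : ∀ q ∈ T ∩ F ⁻¹' ({0} ×ˢ Ici 0), q.2.2 < s₂ := by
    rintro ⟨x, y, s⟩ ⟨⟨hsI, hx, hy⟩, hq1, hq2⟩
    refine lt_of_le_of_ne hsI.2 ?_
    rintro rfl
    simp only [F, mem_singleton_iff, mem_Ici] at hx hy hq1 hq2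
    have h1 := hdiff x hx y hy
    have h2 : |x - y| ≤ 0 := by
      by_contra! h
      linarith [mul_pos hL h]
    have hxy : x = y := sub_eq_zero.1 (abs_nonpos_iff.1 h2)
    subst hxy
    have h3 : √(Ψ x s) ≤ √(u x s) := by simpa using hq2
    have h4 : Ψ x s ≤ u x s := (Real.sqrt_le_sqrt_iff (H.sub_nonneg _ (hmem x hx))).1 h3
    have hbd := H.boundary s hs₂
    have : x = ρ₁ s ∨ x = ρ₂ s := by
      simpa [sub_eq_zero] using hq1
    rcases this with rfl | rfl
    · exact absurd h4 (not_le.2 hbd.1)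
    · exact absurd h4 (not_le.2 hbd.2)
  obtain ⟨h, hh, hgap⟩ : ∃ h > 0, ∀ q ∈ T ∩ F ⁻¹' ({0} ×ˢ Ici 0), q.2.2 < s₂ - h := by
    rcases (T ∩ F ⁻¹' ({0} ×ˢ Ici 0)).eq_empty_or_nonempty with hemp | hne
    · exact ⟨1, one_pos, by simp [hemp]⟩
    · obtain ⟨q₀, hq₀, hmax⟩ := hK.exists_isMaxOn hne
        (f := fun q : ℝ × ℝ × ℝ => q.2.2) (by fun_prop)
      refine ⟨(s₂ - q₀.2.2) / 2, by linarith [hbefore q₀ hq₀], fun q hq => ?_⟩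
      have : q.2.2 ≤ q₀.2.2 := hmax hq
      linarith [hbefore q₀ hq₀]
  refine ⟨2 * L, by positivity, h, hh, fun x hx y hy => ?_, fun q hq hqs hbd => ?_⟩
  · have := mul_nonneg hL.le (abs_nonneg (x - y))
    linarith [hdiff x hx y hy]
  · by_contra! hge
    refine absurd (hgap q ⟨hq, ?_, _root_.sub_nonneg.2 hge⟩) (not_lt.2 hqs)
    simp only [F, mem_singleton_iff]
    by_contra hne
    refine hbd ⟨⟨lt_of_le_of_ne hq.2.1.1 ?_, lt_of_le_of_ne hq.2.1.2 ?_⟩,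
      lt_of_le_of_ne hq.2.2.1 ?_, lt_of_le_of_ne hq.2.2.2 ?_⟩ <;>
    · intro heq
      simp [heq] at hne

lemma exists_reaction_bound (H : IsComparisonPair C₀ s₁ s₂ ρ₁ ρ₂ u Ψ) (hs : s₁ ≤ s₂) (P : ℝ) :
    ∃ C ≥ 0, ∀ q ∈ movingSquare s₁ s₂ ρ₁ ρ₂, ∀ p ∈ Icc (-P) P,
      sqrtReaction C₀ q.1 √(u q.1 q.2.2) p - sqrtReaction C₀ q.2.1 √(Ψ q.2.1 q.2.2) p
        ≤ C * (|q.1 - q.2.1| + |√(u q.1 q.2.2) - √(Ψ q.2.1 q.2.2)|) := by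
  have hT := isCompact_movingSquare H.left_cont H.right_cont
  obtain ⟨t, ht, hmin⟩ := isCompact_Icc.exists_isMinOn (nonempty_Icc.2 hs) H.left_cont
  obtain ⟨t', ht', hmax⟩ := isCompact_Icc.exists_isMaxOn (nonempty_Icc.2 hs) H.right_cont
  have hu := H.sub_cont.comp (f := fun q : ℝ × ℝ × ℝ => (q.1, q.2.2)) (by fun_prop)
    fun _ => movingSquare_fst
  have hΨ := H.super_cont.comp (f := fun q : ℝ × ℝ × ℝ => (q.2.1, q.2.2)) (by fun_prop)
    fun _ => movingSquare_snd
  obtain ⟨B₁, hB₁⟩ := hT.exists_bound_of_continuousOn hu.sqrt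
  obtain ⟨B₂, hB₂⟩ := hT.exists_bound_of_continuousOn hΨ.sqrt
  obtain ⟨C, hC, hbound⟩ := exists_sqrtReaction_sub_le C₀ (ρ₂ t') (max B₁ B₂) P
    (H.left_pos t ht)
  refine ⟨C, hC, fun q hq p hp => hbound _ ?_ _ ?_ _ ?_ _ ?_ p hp⟩
  · exact ⟨(hmin hq.1).trans hq.2.1.1, hq.2.1.2.trans (hmax hq.1)⟩
  · exact ⟨(hmin hq.1).trans hq.2.2.1, hq.2.2.2.trans (hmax hq.1)⟩
  · exact ⟨Real.sqrt_nonneg _, ((le_abs_self _).trans (hB₁ q hq)).trans (le_max_left _ _)⟩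
  · exact ⟨Real.sqrt_nonneg _, ((le_abs_self _).trans (hB₂ q hq)).trans (le_max_right _ _)⟩

/-- The ordering at the final time persists for a short time backward. -/
lemma exists_le_of_le_final (H : IsComparisonPair C₀ s₁ s₂ ρ₁ ρ₂ u Ψ) (hs : s₁ ≤ s₂)
    (hfinal : ∀ r ∈ Icc (ρ₁ s₂) (ρ₂ s₂), u r s₂ ≤ Ψ r s₂) :
    ∃ h > 0, ∀ p ∈ movingStrip s₁ s₂ ρ₁ ρ₂, s₂ - h ≤ p.2 → u p.1 p.2 ≤ Ψ p.1 p.2 := by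
  obtain ⟨m, hm, h₀, hh₀, hinit, hbd⟩ := H.exists_boundary_gap hs hfinal
  obtain ⟨C, hC, hreact⟩ := H.exists_reaction_bound hs (2 * m)
  set Λ := 8 * m ^ 2 + C * (1 / m + 2) with hΛ
  have hΛpos : 0 < Λ := by positivity
  set h := min h₀ (1 / Λ)
  have hh : 0 < h := lt_min hh₀ (by positivity)
  have hhh₀ : h ≤ h₀ := min_le_left _ _
  have hΛh : Λ * h ≤ 1 := by
    have : h ≤ 1 / Λ := min_le_right _ _
    rwa [le_div_iff₀ hΛpos, mul_comm] at this
  have hT := isCompact_movingSquare H.left_cont H.right_cont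
  have penalized : ∀ ε > 0, ∀ q ∈ movingSquare s₁ s₂ ρ₁ ρ₂, s₂ - h ≤ q.2.2 →
      √(u q.1 q.2.2) - √(Ψ q.2.1 q.2.2)
        < (1 + Λ * (s₂ - q.2.2)) * √(ε ^ 2 + m ^ 2 * (q.1 - q.2.1) ^ 2) := by
    intro ε hε
    have hpen : ∀ q ∈ movingSquare s₁ s₂ ρ₁ ρ₂, m * |q.1 - q.2.1|
        < (1 + Λ * (s₂ - q.2.2)) * √(ε ^ 2 + m ^ 2 * (q.1 - q.2.1) ^ 2) := by
      intro q hq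
      have h1 : m * |q.1 - q.2.1| < √(ε ^ 2 + m ^ 2 * (q.1 - q.2.1) ^ 2) := by
        refine Real.lt_sqrt_of_sq_lt ?_
        rw [mul_pow, sq_abs]
        linarith [pow_pos hε 2]
      have h2 : 0 ≤ Λ * (s₂ - q.2.2) := mul_nonneg hΛpos.le (_root_.sub_nonneg.2 hq.1.2)
      nlinarith [Real.sqrt_nonneg (ε ^ 2 + m ^ 2 * (q.1 - q.2.1) ^ 2)]
    let F : ℝ × ℝ × ℝ → ℝ × ℝ := fun q => (q.2.2, √(u q.1 q.2.2) - √(Ψ q.2.1 q.2.2)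
      - (1 + Λ * (s₂ - q.2.2)) * √(ε ^ 2 + m ^ 2 * (q.1 - q.2.1) ^ 2))
    have hF : ContinuousOn F (movingSquare s₁ s₂ ρ₁ ρ₂) :=
      ContinuousOn.prodMk (by fun_prop) (H.continuousOn_sqrt_sub.sub (by fun_prop))
    have hK : IsCompact (movingSquare s₁ s₂ ρ₁ ρ₂ ∩ F ⁻¹' (Ici (s₂ - h) ×ˢ Ici 0)) :=
      hT.of_isClosed_subset (hF.preimage_isClosed_of_isClosed hT.isClosed
        (isClosed_Ici.prod isClosed_Ici)) inter_subset_left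
    by_contra! ⟨q, hq, hqs, hge⟩
    obtain ⟨⟨x, y, s⟩, ⟨hq₀, hsh, hge₀⟩, hmax⟩ := hK.exists_isMaxOn
      ⟨q, hq, hqs, _root_.sub_nonneg.2 hge⟩ (f := fun q : ℝ × ℝ × ℝ => q.2.2) (by fun_prop)
    replace hge₀ := _root_.sub_nonneg.1 (mem_Ici.1 hge₀)
    simp only [F, mem_Ici] at hsh hge₀
    have hlt := (hpen _ hq₀).trans_le hge₀
    have hss₂ : s < s₂ := by
      refine lt_of_le_of_ne hq₀.1.2 ?_
      rintro rfl
      exact absurd hlt (not_lt.2 (hinit x hq₀.2.1 y hq₀.2.2))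
    have hint : x ∈ Ioo (ρ₁ s) (ρ₂ s) ∧ y ∈ Ioo (ρ₁ s) (ρ₂ s) := by
      by_contra hcon
      exact lt_asymm hlt (hbd _ hq₀ (show s₂ - h₀ ≤ s by linarith) hcon)
    refine absurd hge₀ (not_le.2 (H.not_touching hm hC hΛ.symm.le hε ⟨hq₀.1.1, hss₂⟩ hint.1
      hint.2 ?_ (hreact _ hq₀) ?_))
    · exact (mul_le_mul_of_nonneg_left (by linarith) hΛpos.le).trans hΛh
    · intro x' y' t ht hx' hy'
      by_contra! hcon
      have : t ≤ s := hmax (a := (x', y', t)) ⟨⟨⟨hq₀.1.1.trans ht.1.le, ht.2⟩, hx', hy'⟩,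
        mem_Ici.2 (hsh.trans ht.1.le), _root_.sub_nonneg.2 hcon⟩
      exact absurd ht.1 (not_lt.2 this)
  refine ⟨h, hh, fun p hp hph => ?_⟩
  rw [← Real.sqrt_le_sqrt_iff (H.super_nonneg p hp)]
  have hΛp : Λ * (s₂ - p.2) ≤ 1 :=
    (mul_le_mul_of_nonneg_left (by linarith) hΛpos.le).trans hΛh
  refine le_of_forall_pos_le_add fun ε hε => ?_
  have := penalized (ε / 2) (by positivity) (p.1, p.1, p.2) ⟨hp.1, hp.2, hp.2⟩ hph
  simp only [sub_self, ne_eq, OfNat.ofNat_ne_zero, not_false_eq_true, zero_pow, mul_zero,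
    add_zero] at this
  rw [Real.sqrt_sq (by positivity)] at this
  nlinarith

/-- The ordering is inherited by limits from later times. -/
lemma le_of_forall_later_le (H : IsComparisonPair C₀ s₁ s₂ ρ₁ ρ₂ u Ψ) {s : ℝ}
    (hs : s ∈ Ico s₁ s₂)
    (hlater : ∀ p ∈ movingStrip s₁ s₂ ρ₁ ρ₂, s < p.2 → u p.1 p.2 ≤ Ψ p.1 p.2) :
    ∀ r ∈ Icc (ρ₁ s) (ρ₂ s), u r s ≤ Ψ r s := by
  intro r hr
  have hsI := Ico_subset_Icc_self hs
  rcases hr.1.eq_or_lt with rfl | h1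
  · exact (H.boundary s hsI).1.le
  rcases hr.2.eq_or_lt with rfl | h2
  · exact (H.boundary s hsI).2.le
  have hmem : (r, s) ∈ movingStrip s₁ s₂ ρ₁ ρ₂ := ⟨hsI, hr⟩
  refine le_of_tendsto_of_tendsto
    ((H.sub_time _ hmem).continuousAt.mono_left nhdsWithin_le_nhds : Tendsto _ (𝓝[>] s) _)
    ((H.super_time _ hmem).continuousAt.mono_left nhdsWithin_le_nhds) ?_
  filter_upwards [H.eventually_mem_Ioo hs ⟨h1, h2⟩, self_mem_nhdsWithin] with t ht hst
  exact hlater (r, t) ⟨ht.1, Ioo_subset_Icc_self ht.2⟩ hst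

theorem le_of_final_le (H : IsComparisonPair C₀ s₁ s₂ ρ₁ ρ₂ u Ψ)
    (hfinal : ∀ r ∈ Icc (ρ₁ s₂) (ρ₂ s₂), u r s₂ ≤ Ψ r s₂) :
    ∀ p ∈ movingStrip s₁ s₂ ρ₁ ρ₂, u p.1 p.2 ≤ Ψ p.1 p.2 := by
  by_contra! ⟨p₀, hp₀, hlt₀⟩
  set T := {s | ∃ p ∈ movingStrip s₁ s₂ ρ₁ ρ₂, p.2 = s ∧ Ψ p.1 p.2 < u p.1 p.2}
  have hne : T.Nonempty := ⟨p₀.2, p₀, hp₀, rfl, hlt₀⟩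
  have hbdd : BddAbove T := ⟨s₂, by rintro _ ⟨p, hp, rfl, -⟩; exact hp.1.2⟩
  set t := sSup T
  have ht₁ : s₁ ≤ t := hp₀.1.1.trans (le_csSup hbdd ⟨p₀, hp₀, rfl, hlt₀⟩)
  have ht₂ : t ≤ s₂ := csSup_le hne (by rintro _ ⟨p, hp, rfl, -⟩; exact hp.1.2)
  have hslice : ∀ r ∈ Icc (ρ₁ t) (ρ₂ t), u r t ≤ Ψ r t := by
    rcases ht₂.eq_or_lt with heq | hlt
    · rwa [heq]
    · refine H.le_of_forall_later_le ⟨ht₁, hlt⟩ fun p hp htp => ?_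
      by_contra! hcon
      exact absurd htp (not_lt.2 (le_csSup hbdd ⟨p, hp, rfl, hcon⟩))
  obtain ⟨h, hh, hle⟩ := (H.restrict ht₂).exists_le_of_le_final ht₁ hslice
  obtain ⟨_, ⟨p, hp, rfl, hlt⟩, hp'⟩ := exists_lt_of_lt_csSup hne (show t - h < t by linarith)
  exact absurd hlt (not_lt.2 (hle p
    ⟨⟨hp.1.1, le_csSup hbdd ⟨p, hp, rfl, hlt⟩⟩, hp.2⟩ hp'.le))

end IsComparisonPair

end

/-- The comparison principle at the core of Proposition 3.8 (backward in s). -/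
theorem comparison_principle
    (C₀ s₁ s₂ : ℝ) (hC₀ : 0 ≤ C₀) (hs : s₁ < s₂)
    (ρ₁ ρ₂ : ℝ → ℝ)
    (hρ₁cont : ContinuousOn ρ₁ (Set.Icc s₁ s₂))
    (hρ₂cont : ContinuousOn ρ₂ (Set.Icc s₁ s₂))
    (hρ₁pos : ∀ s ∈ Set.Icc s₁ s₂, 0 < ρ₁ s)
    (hρlt : ∀ s ∈ Set.Icc s₁ s₂, ρ₁ s < ρ₂ s)
    (u Ψ : ℝ → ℝ → ℝ)
    (Ω : Set (ℝ × ℝ))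
    (hΩ : Ω = {p : ℝ × ℝ | p.2 ∈ Set.Icc s₁ s₂ ∧ p.1 ∈ Set.Icc (ρ₁ p.2) (ρ₂ p.2)})
    (hucont : ContinuousOn (fun p : ℝ × ℝ => u p.1 p.2) Ω)
    (hΨcont : ContinuousOn (fun p : ℝ × ℝ => Ψ p.1 p.2) Ω)
    (hus : ∀ p ∈ Ω, ContDiffAt ℝ 1 (fun s => u p.1 s) p.2)
    (hur : ∀ p ∈ Ω, ContDiffAt ℝ 2 (fun r => u r p.2) p.1)
    (hΨs : ∀ p ∈ Ω, ContDiffAt ℝ 1 (fun s => Ψ p.1 s) p.2)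
    (hΨr : ∀ p ∈ Ω, ContDiffAt ℝ 2 (fun r => Ψ r p.2) p.1)
    (hunonneg : ∀ p ∈ Ω, 0 ≤ u p.1 p.2)
    (hΨnonneg : ∀ p ∈ Ω, 0 ≤ Ψ p.1 p.2)
    (hineq_u : ∀ p ∈ Ω,
      - deriv (fun s => u p.1 s) p.2
        ≤ u p.1 p.2 * deriv (deriv (fun r => u r p.2)) p.1
          - (1/2) * (deriv (fun r => u r p.2) p.1) ^ 2
          + p.1⁻¹ ^ 2 * (1 - u p.1 p.2)
            * (p.1 * deriv (fun r => u r p.2) p.1 + 2 * u p.1 p.2)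
          + C₀ * Real.sqrt (u p.1 p.2) * p.1⁻¹ ^ 4)
    (hineq_Ψ : ∀ p ∈ Ω,
      - deriv (fun s => Ψ p.1 s) p.2
        > Ψ p.1 p.2 * deriv (deriv (fun r => Ψ r p.2)) p.1
          - (1/2) * (deriv (fun r => Ψ r p.2) p.1) ^ 2
          + p.1⁻¹ ^ 2 * (1 - Ψ p.1 p.2)
            * (p.1 * deriv (fun r => Ψ r p.2) p.1 + 2 * Ψ p.1 p.2)
          + 2 * C₀ * Real.sqrt (Ψ p.1 p.2) * p.1⁻¹ ^ 4)
    (hbdry : ∀ s ∈ Set.Icc s₁ s₂, u (ρ₁ s) s < Ψ (ρ₁ s) s ∧ u (ρ₂ s) s < Ψ (ρ₂ s) s)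
    (hfinal : ∀ r ∈ Set.Icc (ρ₁ s₂) (ρ₂ s₂), u r s₂ ≤ Ψ r s₂) :
    ∀ p ∈ Ω, u p.1 p.2 ≤ Ψ p.1 p.2 := by
  subst hΩ
  exact IsComparisonPair.le_of_final_le ⟨hC₀, hρ₁cont, hρ₂cont, hρ₁pos, hρlt, hucont, hΨcont, hus,
    hur, hΨs, hΨr, hunonneg, hΨnonneg, hineq_u, hineq_Ψ, hbdry⟩ hfinal
end
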